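/- arXiv:1101.3282 — 3 statements merged into one kernel-verified Lean document; each statement's English description precedes it below -/
import Mathlib

section
/- Let φ: M^m → N^{m+1} be an isometric immersion of codimension one with mean curvature vector η = Hξ, where ξ is a unit normal vector field, A is the shape operator with respect to ξ, and Ric^N is the Ricci operator of N. Then φ is biharmonic if and only if ΔH − H|A|² + H·Ric^N(ξ,ξ) = 0 and 2A(grad H) + (m/2)·grad(H²) − 2H·(Ric^N(ξ))^⊤ = 0, where (·)^⊤ denotes the tangential component along M. -/
/-!
Coordinate-based Riemannian geometry on charts `ℝⁿ`, enough to express mean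
curvature, second fundamental forms, curvature tensors and the (bi)tension
fields of isometric immersions, as used in
"Constant mean curvature and totally umbilical biharmonic surfaces in
3-dimensional geometries".
-/

noncomputable section

open scoped BigOperators

/-- A point of the coordinate chart `ℝⁿ`. -/
abbrev Pt (n : ℕ) := Fin n → ℝ

/-- A Riemannian metric on (an open part of) `ℝⁿ`, given by its coordinate matrix. -/
abbrev Met (n : ℕ) := Pt n → Matrix (Fin n) (Fin n) ℝ

/-- A vector field on `ℝⁿ`, in coordinates. -/
abbrev VF (n : ℕ) := Pt n → Pt n

/-- The inner product of tangent vectors `v`, `w` at the point `p`, w.r.t. `g`. -/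
def gip {n : ℕ} (g : Met n) (p v w : Pt n) : ℝ := ∑ i, ∑ j, g p i j * v i * w j

/-- `g` is a Riemannian metric: smooth, symmetric and positive definite. -/
structure IsRiemannian {n : ℕ} (g : Met n) : Prop where
  smooth : ∀ i j, ContDiff ℝ (⊤ : ℕ∞) fun p => g p i j
  symm : ∀ p i j, g p i j = g p j i
  posdef : ∀ p v, v ≠ 0 → 0 < gip g p v v

/-- Christoffel symbols `Γ^k_{ij}` of the Levi-Civita connection of `g`. -/
def christoffel {n : ℕ} (g : Met n) (p : Pt n) (k i j : Fin n) : ℝ :=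
  (1 / 2) * ∑ l, (g p)⁻¹ k l *
    (fderiv ℝ (fun q => g q j l) p (Pi.single i 1)
      + fderiv ℝ (fun q => g q i l) p (Pi.single j 1)
      - fderiv ℝ (fun q => g q i j) p (Pi.single l 1))

/-- The Levi-Civita covariant derivative `∇_X Y` of vector fields, in coordinates. -/
def cov {n : ℕ} (g : Met n) (X Y : VF n) : VF n := fun p k =>
  fderiv ℝ (fun q => Y q k) p (X p) + ∑ i, ∑ j, christoffel g p k i j * X p i * Y p j

/-- The Lie bracket `[X, Y]` of vector fields. -/
def lieB {n : ℕ} (X Y : VF n) : VF n := fun p k =>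
  fderiv ℝ (fun q => Y q k) p (X p) - fderiv ℝ (fun q => X q k) p (Y p)

/-- The curvature operator `R(X,Y)Z = ∇_X ∇_Y Z − ∇_Y ∇_X Z − ∇_{[X,Y]} Z`. -/
def curvOp {n : ℕ} (g : Met n) (X Y Z : VF n) : VF n := fun p =>
  cov g X (cov g Y Z) p - cov g Y (cov g X Z) p - cov g (lieB X Y) Z p

/-- The curvature tensor evaluated on tangent vectors at `p` (via constant extensions). -/
def curvPt {n : ℕ} (g : Met n) (p v w z : Pt n) : Pt n :=
  curvOp g (fun _ => v) (fun _ => w) (fun _ => z) p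

/-- The Ricci curvature `Ric(v, w) = trace (z ↦ R(z, v) w)` at `p`; for the Levi-Civita
connection of a Riemannian metric this agrees with `Σᵢ ⟨R(v, eᵢ) eᵢ, w⟩` for any
orthonormal frame `{eᵢ}`. -/
def ricci {n : ℕ} (g : Met n) (p v w : Pt n) : ℝ :=
  ∑ k, curvPt g p (Pi.single k 1) v w k

/-- The differential of `φ` at `u`, applied to the `a`-th coordinate direction. -/
def dmap {m n : ℕ} (φ : Pt m → Pt n) (u : Pt m) (a : Fin m) : Pt n := fun k =>
  fderiv ℝ (fun q => φ q k) u (Pi.single a 1)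

/-- The pushforward `dφ_u(v)` of a tangent vector of the domain. -/
def push {m n : ℕ} (φ : Pt m → Pt n) (u : Pt m) (v : Pt m) : Pt n := fun k =>
  fderiv ℝ (fun q => φ q k) u v

/-- The first fundamental form (induced metric) of the immersion `φ`. -/
def fff {m n : ℕ} (g : Met n) (φ : Pt m → Pt n) : Met m := fun u =>
  Matrix.of fun a b => gip g (φ u) (dmap φ u a) (dmap φ u b)

/-- `φ` is a smooth immersion. -/
def IsImmersion {m n : ℕ} (φ : Pt m → Pt n) : Prop :=
  (∀ k, ContDiff ℝ (⊤ : ℕ∞) fun u => φ u k) ∧ ∀ u, LinearIndependent ℝ (dmap φ u)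

/-- `ξ` is a (smooth) unit normal vector field along the immersion `φ`. -/
def IsUnitNormal {m n : ℕ} (g : Met n) (φ ξ : Pt m → Pt n) : Prop :=
  (∀ k, ContDiff ℝ (⊤ : ℕ∞) fun u => ξ u k) ∧ (∀ u, gip g (φ u) (ξ u) (ξ u) = 1) ∧
    ∀ u a, gip g (φ u) (ξ u) (dmap φ u a) = 0

/-- The second fundamental form `h_{ab} = ⟨∇^N_{∂_a} dφ(∂_b), ξ⟩` of `φ` w.r.t. `ξ`. -/
def sff {m n : ℕ} (g : Met n) (φ ξ : Pt m → Pt n) (u : Pt m) (a b : Fin m) : ℝ :=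
  gip g (φ u)
    (fun k => fderiv ℝ (fun q => dmap φ q b k) u (Pi.single a 1)
      + ∑ i, ∑ j, christoffel g (φ u) k i j * dmap φ u a i * dmap φ u b j)
    (ξ u)

/-- The shape operator `A^a_b = G^{ac} h_{cb}` of `φ` w.r.t. `ξ` (`G` the induced metric). -/
def shapeOp {m n : ℕ} (g : Met n) (φ ξ : Pt m → Pt n) (u : Pt m) (a b : Fin m) : ℝ :=
  ∑ c, (fff g φ u)⁻¹ a c * sff g φ ξ u c b

/-- The mean curvature `H = (1/m) ⋅ trace A` of the hypersurface `φ` w.r.t. `ξ`. -/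
def meanCurv {m n : ℕ} (g : Met n) (φ ξ : Pt m → Pt n) (u : Pt m) : ℝ :=
  (1 / (m : ℝ)) * ∑ a, shapeOp g φ ξ u a a

/-- The squared norm `|A|²` of the shape operator (= of the second fundamental form). -/
def normA2 {m n : ℕ} (g : Met n) (φ ξ : Pt m → Pt n) (u : Pt m) : ℝ :=
  ∑ a, ∑ b, shapeOp g φ ξ u a b * shapeOp g φ ξ u b a

/-- `φ` is totally umbilical w.r.t. `ξ`: at every point both principal curvatures are
equal, i.e. the second fundamental form is a scalar multiple of the induced metric
(equivalently, the shape operator is a scalar multiple of the identity). -/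
def IsTotallyUmbilical {m n : ℕ} (g : Met n) (φ ξ : Pt m → Pt n) : Prop :=
  ∃ lam : Pt m → ℝ, ∀ u a b, sff g φ ξ u a b = lam u * fff g φ u a b

/-- The tension field `τ(φ) = Trace_g ∇ dφ` of the isometric immersion `φ`
(the domain carrying the induced metric). -/
def tension {m n : ℕ} (g : Met n) (φ : Pt m → Pt n) (u : Pt m) : Pt n := fun k =>
  ∑ a, ∑ b, (fff g φ u)⁻¹ a b *
    (fderiv ℝ (fun q => dmap φ q b k) u (Pi.single a 1)
      - ∑ c, christoffel (fff g φ) u c a b * dmap φ u c k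
      + ∑ i, ∑ j, christoffel g (φ u) k i j * dmap φ u a i * dmap φ u b j)

/-- The pull-back covariant derivative `∇^φ_{∂_a} V` of a vector field `V` along `φ`. -/
def covAlong {m n : ℕ} (g : Met n) (φ : Pt m → Pt n) (V : Pt m → Pt n) (a : Fin m) :
    Pt m → Pt n := fun u k =>
  fderiv ℝ (fun q => V q k) u (Pi.single a 1)
    + ∑ i, ∑ j, christoffel g (φ u) k i j * dmap φ u a i * V u j

/-- The bitension field
`τ₂(φ) = Trace_g (∇^φ ∇^φ − ∇^φ_{∇^M}) τ(φ) − Trace_g R^N(dφ, τ(φ)) dφ`. -/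
def bitension {m n : ℕ} (g : Met n) (φ : Pt m → Pt n) (u : Pt m) : Pt n := fun k =>
  (∑ a, ∑ b, (fff g φ u)⁻¹ a b *
      (covAlong g φ (covAlong g φ (tension g φ) b) a u k
        - ∑ c, christoffel (fff g φ) u c a b * covAlong g φ (tension g φ) c u k))
    - ∑ a, ∑ b, (fff g φ u)⁻¹ a b *
        curvPt g (φ u) (dmap φ u a) (tension g φ u) (dmap φ u b) k

/-- `φ` is a biharmonic isometric immersion: its bitension field vanishes.  (This is the
Euler–Lagrange characterisation of the critical points of the bienergy
`E²(φ,Ω) = (1/2)∫_Ω |τ(φ)|²` for every compact `Ω`.) -/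
def IsBiharmonic {m n : ℕ} (g : Met n) (φ : Pt m → Pt n) : Prop := ∀ u, bitension g φ u = 0

/-- `φ` is minimal (equivalently, harmonic): its tension field vanishes, i.e. `H ≡ 0`. -/
def IsMinimal {m n : ℕ} (g : Met n) (φ : Pt m → Pt n) : Prop := ∀ u, tension g φ u = 0

/-- `φ` is proper biharmonic: biharmonic and not minimal. -/
def IsProperBiharmonic {m n : ℕ} (g : Met n) (φ : Pt m → Pt n) : Prop :=
  IsBiharmonic g φ ∧ ¬IsMinimal g φ

/-! ### The Bianchi–Cartan–Vranceanu spaces `M³_{m,l}`, Sol, hyperbolic and flat space -/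

/-- `F = 1 + m (x² + y²)`. -/
def bcvF (m : ℝ) (p : Pt 3) : ℝ := 1 + m * (p 0 ^ 2 + p 1 ^ 2)

/-- The coordinate covector of the one-form `dz + (l/2)(y dx − x dy)/F`. -/
def bcvω (m l : ℝ) (p : Pt 3) : Pt 3 :=
  ![l * p 1 / (2 * bcvF m p), -(l * p 0) / (2 * bcvF m p), 1]

/-- The Bianchi–Cartan–Vranceanu metric
`g = (dx² + dy²)/(1 + m(x²+y²))² + (dz + (l/2)(y dx − x dy)/(1 + m(x²+y²)))²` on `ℝ³`. -/
def bcvMet (m l : ℝ) : Met 3 := fun p =>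
  Matrix.of fun i j =>
    (if i = j ∧ (i : ℕ) < 2 then 1 / bcvF m p ^ 2 else 0) + bcvω m l p i * bcvω m l p j

/-- The frame `E₁ = F ∂_x − (l y/2) ∂_z`, `E₂ = F ∂_y + (l x/2) ∂_z`, `E₃ = ∂_z`
on the BCV space `M³_{m,l}`. -/
def bcvE (m l : ℝ) : Fin 3 → VF 3 :=
  ![fun p => ![bcvF m p, 0, -(l * p 1) / 2],
    fun p => ![0, bcvF m p, l * p 0 / 2],
    fun _ => ![0, 0, 1]]

/-- The base metric `h = (dx² + dy²)/(1 + m(x²+y²))²` on `ℝ²` of the BCV Riemannian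
submersion `π : M³_{m,l} → (ℝ², h)`, `π(x,y,z) = (x,y)`. -/
def bcvBase (m : ℝ) : Met 2 := fun p =>
  Matrix.of fun i j => if i = j then 1 / (1 + m * (p 0 ^ 2 + p 1 ^ 2)) ^ 2 else 0

/-- The geodesic curvature of a unit-speed curve `α` in `(ℝ², h)`, with respect to the
unit normal obtained by rotating `α'` by `+π/2` (a Euclidean rotation, which is also an
`h`-rotation since `h` is conformal to the flat metric). -/
def geodCurv (m : ℝ) (α : ℝ → Pt 2) (s : ℝ) : ℝ :=
  gip (bcvBase m) (α s)
    (fun k => deriv (fun t => deriv α t k) s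
      + ∑ i, ∑ j, christoffel (bcvBase m) (α s) k i j * deriv α s i * deriv α s j)
    ![-deriv α s 1, deriv α s 0]

/-- `φ` parametrises part of the Hopf cylinder `π⁻¹(α(I))` over a circle of radius
`1/√(8m − l²)` in the base sphere `S²(1/(2√m))`, identified with `(ℝ², h)`.  (In the
base sphere, which has Gaussian curvature `4m` and extrinsic normal curvature `2√m`,
the circles of radius `1/√(8m − l²)` are exactly the curves of constant geodesic
curvature `κ₀` with `κ₀² = (8m − l²) − 4m = 4m − l²`.) -/
def PartOfHopfCylinderOverCircle (m l : ℝ) (φ : Pt 2 → Pt 3) : Prop :=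
  ∃ α : ℝ → Pt 2, ContDiff ℝ (⊤ : ℕ∞) α ∧
    (∀ s, gip (bcvBase m) (α s) (deriv α s) (deriv α s) = 1) ∧
    (∃ κ₀ : ℝ, κ₀ ^ 2 = 4 * m - l ^ 2 ∧ ∀ s, geodCurv m α s = κ₀) ∧
    ∀ u, ∃ s, φ u 0 = α s 0 ∧ φ u 1 = α s 1

/-- The Sol metric `g_{Sol} = e^{2z} dx² + e^{−2z} dy² + dz²` on `ℝ³`. -/
def solMet : Met 3 := fun p =>
  Matrix.of fun i j =>
    if i = j then
      if (i : ℕ) = 0 then Real.exp (2 * p 2)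
      else if (i : ℕ) = 1 then Real.exp (-(2 * p 2)) else 1
    else 0

/-- The orthonormal frame `E₁ = e^{−z} ∂_x`, `E₂ = e^{z} ∂_y`, `E₃ = ∂_z` on Sol space. -/
def solE : Fin 3 → VF 3 :=
  ![fun p => ![Real.exp (-p 2), 0, 0],
    fun p => ![0, Real.exp (p 2), 0],
    fun _ => ![0, 0, 1]]

/-- Hyperbolic 3-space `H³` in horospherical coordinates: `g = e^{2z}(dx² + dy²) + dz²`. -/
def hypMet : Met 3 := fun p =>
  Matrix.of fun i j => if i = j then (if (i : ℕ) < 2 then Real.exp (2 * p 2) else 1) else 0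

/-- The flat metric on `ℝ³`. -/
def euclMet : Met 3 := fun _ => 1

/-- The gradient (raised index) of a scalar function w.r.t. the metric `G`. -/
def gradS {m : ℕ} (G : Met m) (f : Pt m → ℝ) (u : Pt m) (a : Fin m) : ℝ :=
  ∑ b, (G u)⁻¹ a b * fderiv ℝ f u (Pi.single b 1)

/-- The Laplace–Beltrami operator of the metric `G` on scalar functions. -/
def lapBel {m : ℕ} (G : Met m) (f : Pt m → ℝ) (u : Pt m) : ℝ :=
  ∑ a, ∑ b, (G u)⁻¹ a b *
    (fderiv ℝ (fun q => fderiv ℝ f q (Pi.single b 1)) u (Pi.single a 1)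
      - ∑ c, christoffel G u c a b * fderiv ℝ f u (Pi.single c 1))

section AbstractGeo

variable {E F : Type*} [NormedAddCommGroup E] [NormedSpace ℝ E]
  [NormedAddCommGroup F] [NormedSpace ℝ F]

structure Geo (Γ : F → F →L[ℝ] F →L[ℝ] F) (γ : F → F →L[ℝ] F →L[ℝ] ℝ) : Prop where
  smΓ : ContDiff ℝ (⊤ : ℕ∞) Γ
  smγ : ContDiff ℝ (⊤ : ℕ∞) γ
  symΓ : ∀ p x y, Γ p x y = Γ p y x
  symγ : ∀ p x y, γ p x y = γ p y x
  compat : ∀ p x y z, fderiv ℝ γ p x y z = γ p (Γ p x y) z + γ p y (Γ p x z)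

def RR (Γ : F → F →L[ℝ] F →L[ℝ] F) (p x y z : F) : F :=
  fderiv ℝ Γ p x y z - fderiv ℝ Γ p y x z + Γ p x (Γ p y z) - Γ p y (Γ p x z)

def DD (Γ : F → F →L[ℝ] F →L[ℝ] F) (φ V : E → F) (a : E) (u : E) : F :=
  fderiv ℝ V u a + Γ (φ u) (fderiv ℝ φ u a) (V u)

variable {Γ : F → F →L[ℝ] F →L[ℝ] F} {γ : F → F →L[ℝ] F →L[ℝ] ℝ}

lemma smooth_fd {φ : E → F} (h : ContDiff ℝ (⊤ : ℕ∞) φ) (a : E) :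
    ContDiff ℝ (⊤ : ℕ∞) (fun q => fderiv ℝ φ q a) := by
  have : ContDiff ℝ (⊤ : ℕ∞) (fderiv ℝ φ) := h.fderiv_right (by simp)
  exact this.clm_apply contDiff_const

lemma smooth_diff {φ : E → F} (h : ContDiff ℝ (⊤ : ℕ∞) φ) : Differentiable ℝ φ :=
  h.differentiable (by simp)

lemma fd_symm {φ : E → F} (h : ContDiff ℝ (⊤ : ℕ∞) φ) (u a b : E) :
    fderiv ℝ (fun q => fderiv ℝ φ q b) u a = fderiv ℝ (fun q => fderiv ℝ φ q a) u b := by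
  have h1 : ContDiff ℝ (⊤ : ℕ∞) (fderiv ℝ φ) := h.fderiv_right (by simp)
  have h2 := (smooth_diff h1 u).hasFDerivAt
  have e : ∀ b a, fderiv ℝ (fun q => fderiv ℝ φ q b) u a = fderiv ℝ (fderiv ℝ φ) u a b := by
    intro b a
    rw [(h2.clm_apply (hasFDerivAt_const b u)).fderiv]
    simp
  rw [e, e]
  have := (h.contDiffAt (x := u)).isSymmSndFDerivAt
    (by simp only [minSmoothness_of_isRCLikeNormedField]; exact WithTop.coe_le_coe.2 le_top)
  exact this a b

lemma DD_smooth (hG : Geo Γ γ) {φ V : E → F} (h : ContDiff ℝ (⊤ : ℕ∞) φ)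
    (hV : ContDiff ℝ (⊤ : ℕ∞) V) (a : E) : ContDiff ℝ (⊤ : ℕ∞) (DD Γ φ V a) := by
  unfold DD
  exact (smooth_fd hV a).add
    (((hG.smΓ.comp h).clm_apply (smooth_fd h a)).clm_apply hV)

lemma ip_smooth (hG : Geo Γ γ) {φ V W : E → F} (h : ContDiff ℝ (⊤ : ℕ∞) φ)
    (hV : ContDiff ℝ (⊤ : ℕ∞) V) (hW : ContDiff ℝ (⊤ : ℕ∞) W) :
    ContDiff ℝ (⊤ : ℕ∞) (fun q => γ (φ q) (V q) (W q)) :=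
  ((hG.smγ.comp h).clm_apply hV).clm_apply hW

lemma DD_metric (hG : Geo Γ γ) {φ V W : E → F} (h : ContDiff ℝ (⊤ : ℕ∞) φ)
    (hV : ContDiff ℝ (⊤ : ℕ∞) V) (hW : ContDiff ℝ (⊤ : ℕ∞) W) (u a : E) :
    fderiv ℝ (fun q => γ (φ q) (V q) (W q)) u a
      = γ (φ u) (DD Γ φ V a u) (W u) + γ (φ u) (V u) (DD Γ φ W a u) := by
  have h1 := (smooth_diff h u).hasFDerivAt
  have h2 := (smooth_diff hV u).hasFDerivAt
  have h3 := (smooth_diff hW u).hasFDerivAt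
  have h4 := ((smooth_diff hG.smγ (φ u)).hasFDerivAt).comp u h1
  have h5 := (h4.clm_apply h2).clm_apply h3
  have h6 := h5.fderiv
  simp only [Function.comp_def] at h6
  rw [h6]
  simp [DD, hG.compat]
  ring

lemma DD_symm (hG : Geo Γ γ) {φ : E → F} (h : ContDiff ℝ (⊤ : ℕ∞) φ) (u a b : E) :
    DD Γ φ (fun q => fderiv ℝ φ q b) a u = DD Γ φ (fun q => fderiv ℝ φ q a) b u := by
  unfold DD
  rw [fd_symm h, hG.symΓ]

lemma DD_comm (hG : Geo Γ γ) {φ V : E → F} (h : ContDiff ℝ (⊤ : ℕ∞) φ)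
    (hV : ContDiff ℝ (⊤ : ℕ∞) V) (u a b : E) :
    DD Γ φ (DD Γ φ V b) a u = DD Γ φ (DD Γ φ V a) b u
      + RR Γ (φ u) (fderiv ℝ φ u a) (fderiv ℝ φ u b) (V u) := by
  have key : ∀ a b, fderiv ℝ (DD Γ φ V b) u a = fderiv ℝ (fun q => fderiv ℝ V q b) u a
      + (fderiv ℝ Γ (φ u) (fderiv ℝ φ u a) (fderiv ℝ φ u b) (V u)
        + Γ (φ u) (fderiv ℝ (fun q => fderiv ℝ φ q b) u a) (V u)
        + Γ (φ u) (fderiv ℝ φ u b) (fderiv ℝ V u a)) := by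
    intro a b
    have h1 := (smooth_diff h u).hasFDerivAt
    have h2 := (smooth_diff hV u).hasFDerivAt
    have h3 := (smooth_diff (smooth_fd h b) u).hasFDerivAt
    have h3' := (smooth_diff (smooth_fd hV b) u).hasFDerivAt
    have h4 := ((smooth_diff hG.smΓ (φ u)).hasFDerivAt).comp u h1
    have h5 := h3'.add ((h4.clm_apply h3).clm_apply h2)
    have h6 : HasFDerivAt (DD Γ φ V b) _ u := h5
    rw [h6.fderiv]
    simp
    abel
  conv_lhs => unfold DD
  conv_rhs => unfold DD
  change fderiv ℝ (DD Γ φ V b) u a + Γ (φ u) _ (DD Γ φ V b u) =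
    fderiv ℝ (DD Γ φ V a) u b + Γ (φ u) _ (DD Γ φ V a u) + _
  rw [key, key, fd_symm h u a b, fd_symm hV u a b]
  simp only [DD, RR, map_add]
  abel

lemma RR_bianchi (hG : Geo Γ γ) (p x y z : F) :
    RR Γ p x y z + RR Γ p y z x + RR Γ p z x y = 0 := by
  have s : ∀ x y z, fderiv ℝ Γ p x y z = fderiv ℝ Γ p x z y := by
    intro x y z
    have h1 := (smooth_diff hG.smΓ p).hasFDerivAt
    have e : ∀ y z, fderiv ℝ Γ p x y z = fderiv ℝ (fun q => Γ q y z) p x := by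
      intro y z
      rw [((h1.clm_apply (hasFDerivAt_const y p)).clm_apply (hasFDerivAt_const z p)).fderiv]
      simp
    rw [e, e]
    congr 2
    ext q
    rw [hG.symΓ]
  unfold RR
  rw [s x y z, s y x z, s z y x, hG.symΓ p y z, hG.symΓ p x z, hG.symΓ p x y]
  abel

lemma RR_anti (p x y z : F) : RR Γ p x y z = - RR Γ p y x z := by
  unfold RR; abel

lemma RR_self (p x z : F) : RR Γ p x x z = 0 := by
  unfold RR; abel

lemma RR_skew (hG : Geo Γ γ) (p x y z w : F) :
    γ p (RR Γ p x y z) w = - γ p (RR Γ p x y w) z := by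
  have hid : ContDiff ℝ (⊤ : ℕ∞) (id : F → F) := contDiff_id
  have hz : ContDiff ℝ (⊤ : ℕ∞) (fun _ : F => z) := contDiff_const
  have hw : ContDiff ℝ (⊤ : ℕ∞) (fun _ : F => w) := contDiff_const
  have key : ∀ x y, fderiv ℝ (fun q => fderiv ℝ (fun q => γ (id q) z w) q y) p x
      = γ p (DD Γ id (DD Γ id (fun _ => z) y) x p) w
        + γ p (DD Γ id (fun _ => z) y p) (DD Γ id (fun _ => w) x p)
        + (γ p (DD Γ id (fun _ => z) x p) (DD Γ id (fun _ => w) y p)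
        + γ p z (DD Γ id (DD Γ id (fun _ => w) y) x p)) := by
    intro x y
    have : (fun q => fderiv ℝ (fun q => γ (id q) z w) q y) = fun q =>
        γ (id q) (DD Γ id (fun _ => z) y q) w + γ (id q) z (DD Γ id (fun _ => w) y q) := by
      ext q
      exact DD_metric hG hid hz hw q y
    rw [this]
    have s1 := ip_smooth hG hid (DD_smooth hG hid hz y) hw
    have s2 := ip_smooth hG hid hz (DD_smooth hG hid hw y)
    have := ((smooth_diff s1 p).hasFDerivAt.add (smooth_diff s2 p).hasFDerivAt).fderiv
    simp only [Pi.add_def] at this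
    rw [this, add_apply, DD_metric hG hid (DD_smooth hG hid hz y) hw,
      DD_metric hG hid hz (DD_smooth hG hid hw y)]
    rfl
  have h1 := fd_symm (ip_smooth hG hid hz hw) p x y
  rw [key, key, DD_comm hG hid hz p x y, DD_comm hG hid hw p x y] at h1
  simp only [map_add, add_apply, fderiv_id, ContinuousLinearMap.id_apply,
    id] at h1
  rw [hG.symγ p (RR Γ p x y w) z]
  linarith

lemma DD_smul {φ V : E → F} {f : E → ℝ} (hf : ContDiff ℝ (⊤ : ℕ∞) f)
    (hV : ContDiff ℝ (⊤ : ℕ∞) V) (u a : E) :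
    DD Γ φ (fun q => f q • V q) a u = f u • DD Γ φ V a u + (fderiv ℝ f u a) • V u := by
  unfold DD
  have := ((smooth_diff hf u).hasFDerivAt.smul (smooth_diff hV u).hasFDerivAt).fderiv
  simp only [Pi.smul_def'] at this
  rw [this]
  simp
  abel

lemma DD_add {φ V W : E → F} (hV : ContDiff ℝ (⊤ : ℕ∞) V)
    (hW : ContDiff ℝ (⊤ : ℕ∞) W) (u a : E) :
    DD Γ φ (fun q => V q + W q) a u = DD Γ φ V a u + DD Γ φ W a u := by
  unfold DD
  have := ((smooth_diff hV u).hasFDerivAt.add (smooth_diff hW u).hasFDerivAt).fderiv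
  simp only [Pi.add_def] at this
  rw [this]
  simp
  abel

lemma RR_lin1 (p : F) (y z : F) : ∃ L : F →L[ℝ] F, ∀ x, L x = RR Γ p x y z := by
  refine ⟨(ContinuousLinearMap.apply ℝ F z).comp
    (((ContinuousLinearMap.apply ℝ (F →L[ℝ] F) y)).comp (fderiv ℝ Γ p))
     - (ContinuousLinearMap.apply ℝ F z).comp (fderiv ℝ Γ p y)
     + (ContinuousLinearMap.apply ℝ F (Γ p y z)).comp (Γ p)
     - (Γ p y).comp ((ContinuousLinearMap.apply ℝ F z).comp (Γ p)), fun x => ?_⟩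
  simp [RR]

lemma RR_lin2 (p : F) (x z : F) (f : ℝ) (y : F) : RR Γ p x (f • y) z = f • RR Γ p x y z := by
  simp [RR, smul_sub, smul_add]

end AbstractGeo

section FrameGeo

set_option linter.unusedSectionVars false

variable {E F ι : Type*} [NormedAddCommGroup E] [NormedSpace ℝ E]
  [NormedAddCommGroup F] [NormedSpace ℝ F] [Fintype ι] [DecidableEq ι]

structure HyFrm (Γ : F → F →L[ℝ] F →L[ℝ] F) (γ : F → F →L[ℝ] F →L[ℝ] ℝ)
    (φ ξ : E → F) (d : ι → E) (Gi : E → ι → ι → ℝ) : Prop where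
  geo : Geo Γ γ
  smφ : ContDiff ℝ (⊤ : ℕ∞) φ
  smξ : ContDiff ℝ (⊤ : ℕ∞) ξ
  smGi : ∀ a b, ContDiff ℝ (⊤ : ℕ∞) fun u => Gi u a b
  symGi : ∀ u a b, Gi u a b = Gi u b a
  inv : ∀ u a c, ∑ b, Gi u a b * γ (φ u) (fderiv ℝ φ u (d b)) (fderiv ℝ φ u (d c))
    = if a = c then 1 else 0
  unit : ∀ u, γ (φ u) (ξ u) (ξ u) = 1
  nor : ∀ u a, γ (φ u) (ξ u) (fderiv ℝ φ u (d a)) = 0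
  compl : ∀ u V, V = ∑ a, ∑ b, (Gi u a b * γ (φ u) V (fderiv ℝ φ u (d a))) • fderiv ℝ φ u (d b)
    + γ (φ u) V (ξ u) • ξ u

/-- frame vector -/
def fe (φ : E → F) (d : ι → E) (a : ι) : E → F := fun q => fderiv ℝ φ q (d a)

def SS (Γ : F → F →L[ℝ] F →L[ℝ] F) (γ : F → F →L[ℝ] F →L[ℝ] ℝ)
    (φ : E → F) (d : ι → E) (u : E) (a b c : ι) : ℝ :=
  γ (φ u) (DD Γ φ (fe φ d b) (d a) u) (fe φ d c u)

def CC (Γ : F → F →L[ℝ] F →L[ℝ] F) (γ : F → F →L[ℝ] F →L[ℝ] ℝ)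
    (φ : E → F) (d : ι → E) (Gi : E → ι → ι → ℝ) (u : E) (c a b : ι) : ℝ :=
  ∑ l, Gi u c l * SS Γ γ φ d u a b l

def hh (Γ : F → F →L[ℝ] F →L[ℝ] F) (γ : F → F →L[ℝ] F →L[ℝ] ℝ)
    (φ ξ : E → F) (d : ι → E) (u : E) (a b : ι) : ℝ :=
  γ (φ u) (DD Γ φ (fe φ d b) (d a) u) (ξ u)

def ff (Γ : F → F →L[ℝ] F →L[ℝ] F) (γ : F → F →L[ℝ] F →L[ℝ] ℝ)
    (φ ξ : E → F) (d : ι → E) (Gi : E → ι → ι → ℝ) (u : E) : ℝ :=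
  ∑ a, ∑ b, Gi u a b * hh Γ γ φ ξ d u a b

def Rc (Γ : F → F →L[ℝ] F →L[ℝ] F) (γ : F → F →L[ℝ] F →L[ℝ] ℝ)
    (φ ξ : E → F) (d : ι → E) (Gi : E → ι → ι → ℝ) (u : E) (v w : F) : ℝ :=
  (∑ a, ∑ b, Gi u a b * γ (φ u) (RR Γ (φ u) (fe φ d a u) v w) (fe φ d b u))
    + γ (φ u) (RR Γ (φ u) (ξ u) v w) (ξ u)

variable {Γ : F → F →L[ℝ] F →L[ℝ] F} {γ : F → F →L[ℝ] F →L[ℝ] ℝ}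
  {φ ξ : E → F} {d : ι → E} {Gi : E → ι → ι → ℝ}

namespace HyFrm

lemma sme (H : HyFrm Γ γ φ ξ d Gi) (a : ι) : ContDiff ℝ (⊤ : ℕ∞) (fe φ d a) := smooth_fd H.smφ _

lemma hsymm (H : HyFrm Γ γ φ ξ d Gi) (u : E) (a b : ι) :
    hh Γ γ φ ξ d u a b = hh Γ γ φ ξ d u b a := by
  unfold hh fe; rw [DD_symm H.geo H.smφ]

lemma Ssymm (H : HyFrm Γ γ φ ξ d Gi) (u : E) (a b c : ι) :
    SS Γ γ φ d u a b c = SS Γ γ φ d u b a c := by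
  unfold SS fe; rw [DD_symm H.geo H.smφ]

lemma Csymm (H : HyFrm Γ γ φ ξ d Gi) (u : E) (a b c : ι) :
    CC Γ γ φ d Gi u c a b = CC Γ γ φ d Gi u c b a := by
  unfold CC; simp only [H.Ssymm u a b]

lemma smh (H : HyFrm Γ γ φ ξ d Gi) (a b : ι) :
    ContDiff ℝ (⊤ : ℕ∞) (fun u => hh Γ γ φ ξ d u a b) :=
  ip_smooth H.geo H.smφ (DD_smooth H.geo H.smφ (H.sme b) _) H.smξ

lemma smf (H : HyFrm Γ γ φ ξ d Gi) : ContDiff ℝ (⊤ : ℕ∞) (ff Γ γ φ ξ d Gi) := by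
  unfold ff
  exact ContDiff.sum fun a _ => ContDiff.sum fun b _ => (H.smGi a b).mul (H.smh a b)

lemma N1 (H : HyFrm Γ γ φ ξ d Gi) (u : E) (a : ι) : γ (φ u) (DD Γ φ ξ (d a) u) (ξ u) = 0 := by
  have h := DD_metric H.geo H.smφ H.smξ H.smξ u (d a)
  simp only [H.unit] at h
  rw [H.geo.symγ (φ u) (ξ u)] at h
  simp at h
  linarith

lemma N2 (H : HyFrm Γ γ φ ξ d Gi) (u : E) (a b : ι) :
    γ (φ u) (DD Γ φ ξ (d a) u) (fe φ d b u) = - hh Γ γ φ ξ d u a b := by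
  have h := DD_metric H.geo H.smφ H.smξ (H.sme b) u (d a)
  simp only [fe, H.nor] at h
  rw [H.geo.symγ (φ u) (ξ u)] at h
  simp at h
  unfold hh
  change γ (φ u) (DD Γ φ ξ (d a) u) (fderiv ℝ φ u (d b)) = _
  linarith

lemma N3 (H : HyFrm Γ γ φ ξ d Gi) (u : E) (a b : ι) :
    γ (φ u) (DD Γ φ (DD Γ φ ξ (d b)) (d a) u) (ξ u)
      = - γ (φ u) (DD Γ φ ξ (d b) u) (DD Γ φ ξ (d a) u) := by
  have h := DD_metric H.geo H.smφ (DD_smooth H.geo H.smφ H.smξ (d b)) H.smξ u (d a)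
  simp only [H.N1] at h
  simp at h
  linarith

lemma De (H : HyFrm Γ γ φ ξ d Gi) (u : E) (a b : ι) :
    DD Γ φ (fe φ d b) (d a) u = ∑ c, CC Γ γ φ d Gi u c a b • fe φ d c u
      + hh Γ γ φ ξ d u a b • ξ u := by
  conv_lhs => rw [H.compl u (DD Γ φ (fe φ d b) (d a) u)]
  congr 1
  rw [Finset.sum_comm]
  refine Finset.sum_congr rfl fun c _ => ?_
  rw [← Finset.sum_smul]
  congr 1
  refine Finset.sum_congr rfl fun l _ => ?_
  rw [H.symGi]; rfl

lemma N4 (H : HyFrm Γ γ φ ξ d Gi) (u : E) (a b c : ι) :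
    γ (φ u) (DD Γ φ (DD Γ φ ξ (d b)) (d a) u) (fe φ d c u)
      = - fderiv ℝ (fun q => hh Γ γ φ ξ d q b c) u (d a)
        + ∑ e, CC Γ γ φ d Gi u e a c * hh Γ γ φ ξ d u b e := by
  have h := DD_metric H.geo H.smφ (DD_smooth H.geo H.smφ H.smξ (d b)) (H.sme c) u (d a)
  simp only [H.N2] at h
  rw [H.De u a c] at h
  simp only [map_add, map_sum, map_smul, H.N1, H.N2, fderiv_fun_neg, smul_eq_mul, neg_apply,
    mul_neg, Finset.sum_neg_distrib, mul_zero, add_zero] at h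
  linarith

lemma dGm (H : HyFrm Γ γ φ ξ d Gi) (u : E) (a b c : ι) :
    fderiv ℝ (fun q => γ (φ q) (fe φ d a q) (fe φ d b q)) u (d c)
      = SS Γ γ φ d u c a b + SS Γ γ φ d u c b a := by
  rw [DD_metric H.geo H.smφ (H.sme a) (H.sme b), H.geo.symγ (φ u) (fe φ d a u)]; rfl

lemma dGi (H : HyFrm Γ γ φ ξ d Gi) (u : E) (a b c : ι) :
    fderiv ℝ (fun q => Gi q a b) u (d c)
      = - ∑ e, (Gi u a e * CC Γ γ φ d Gi u b c e + Gi u e b * CC Γ γ φ d Gi u a c e) := by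
  let G : Matrix ι ι ℝ := Matrix.of fun a b => γ (φ u) (fe φ d a u) (fe φ d b u)
  let I : Matrix ι ι ℝ := Matrix.of fun a b => Gi u a b
  let I' : Matrix ι ι ℝ := Matrix.of fun a b => fderiv ℝ (fun q => Gi q a b) u (d c)
  let S : Matrix ι ι ℝ := Matrix.of fun a b => SS Γ γ φ d u c a b
  have h1 : I * G = 1 := by
    ext a c
    rw [Matrix.mul_apply, Matrix.one_apply]; exact H.inv u a c
  have h1' : G * I = 1 := mul_eq_one_comm.1 h1
  have h2 : I' * G + I * (S + S.transpose) = 0 := by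
    ext p q
    have : fderiv ℝ (fun u => ∑ b, Gi u p b * γ (φ u) (fe φ d b u) (fe φ d q u)) u (d c) = 0 := by
      have : (fun u => ∑ b, Gi u p b * γ (φ u) (fe φ d b u) (fe φ d q u))
        = fun _ => if p = q then 1 else 0 := by
        ext u; exact H.inv u p q
      rw [this]; simp
    have hs : ∀ b ∈ Finset.univ, DifferentiableAt ℝ
        (fun u => Gi u p b * γ (φ u) (fe φ d b u) (fe φ d q u)) u := fun b _ =>
      smooth_diff ((H.smGi p b).mul (ip_smooth H.geo H.smφ (H.sme b) (H.sme q))) u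
    rw [fderiv_fun_sum hs] at this
    simp only [sum_apply] at this
    rw [Matrix.add_apply, Matrix.mul_apply, Matrix.mul_apply, ← Finset.sum_add_distrib,
      Matrix.zero_apply, ← this]
    refine Finset.sum_congr rfl fun b _ => ?_
    rw [fderiv_fun_mul (smooth_diff (H.smGi p b) u)
      (smooth_diff (ip_smooth H.geo H.smφ (H.sme b) (H.sme q)) u)]
    simp only [add_apply, smul_apply, smul_eq_mul, H.dGm]
    simp [I', G, I, S]
    ring
  have h3 : I' = - (I * (S + S.transpose) * I) := by
    have : I' * G = - (I * (S + S.transpose)) := eq_neg_of_add_eq_zero_left h2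
    calc I' = I' * G * I := by rw [mul_assoc, h1', mul_one]
      _ = _ := by rw [this, neg_mul]
  have hI : I.transpose = I := by ext p q; exact H.symGi u q p
  have h4 : I' = - (I * (I * S.transpose).transpose + (I * S.transpose) * I) := by
    rw [h3, Matrix.transpose_mul, Matrix.transpose_transpose, hI]; noncomm_ring
  have h5 : ∀ p q, (I * S.transpose) p q = CC Γ γ φ d Gi u p c q := fun p q => by
    rw [Matrix.mul_apply]; rfl
  have h6 := congrFun (congrFun h4 a) b
  rw [Matrix.neg_apply, Matrix.add_apply, Matrix.mul_apply, Matrix.mul_apply,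
    ← Finset.sum_add_distrib] at h6
  simp only [Matrix.transpose_apply, h5] at h6
  refine h6.trans ?_
  congr 1
  refine Finset.sum_congr rfl fun e _ => ?_
  simp only [I, Matrix.of_apply]
  ring

lemma df (H : HyFrm Γ γ φ ξ d Gi) (u : E) (c : ι) :
    fderiv ℝ (ff Γ γ φ ξ d Gi) u (d c)
      = ∑ a, ∑ b, (fderiv ℝ (fun q => Gi q a b) u (d c) * hh Γ γ φ ξ d u a b
        + Gi u a b * fderiv ℝ (fun q => hh Γ γ φ ξ d q a b) u (d c)) := by
  have h : HasFDerivAt (ff Γ γ φ ξ d Gi) (∑ a, ∑ b,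
      (Gi u a b • fderiv ℝ (fun q => hh Γ γ φ ξ d q a b) u
        + hh Γ γ φ ξ d u a b • fderiv ℝ (fun q => Gi q a b) u)) u := by
    unfold ff
    refine HasFDerivAt.fun_sum fun a _ => HasFDerivAt.fun_sum fun b _ => ?_
    exact (smooth_diff (H.smGi a b) u).hasFDerivAt.mul (smooth_diff (H.smh a b) u).hasFDerivAt
  rw [h.fderiv]
  simp only [sum_apply, add_apply, smul_apply, smul_eq_mul]
  refine Finset.sum_congr rfl fun a _ => Finset.sum_congr rfl fun b _ => ?_
  ring

lemma Rcsymm (H : HyFrm Γ γ φ ξ d Gi) (u : E) (v w : F) :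
    Rc Γ γ φ ξ d Gi u v w = Rc Γ γ φ ξ d Gi u w v := by
  have key : ∀ z, RR Γ (φ u) z v w - RR Γ (φ u) z w v = - RR Γ (φ u) v w z := by
    intro z
    have := RR_bianchi H.geo (φ u) z v w
    rw [RR_anti (φ u) w z v] at this
    rw [eq_neg_iff_add_eq_zero, ← this]; abel
  have t : ∑ a, ∑ b, Gi u a b * γ (φ u) (RR Γ (φ u) v w (fe φ d a u)) (fe φ d b u) = 0 := by
    have : ∑ a, ∑ b, Gi u a b * γ (φ u) (RR Γ (φ u) v w (fe φ d a u)) (fe φ d b u)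
      = - ∑ a, ∑ b, Gi u a b * γ (φ u) (RR Γ (φ u) v w (fe φ d a u)) (fe φ d b u) := by
      conv_lhs => rw [Finset.sum_comm]
      simp only [← Finset.sum_neg_distrib]
      refine Finset.sum_congr rfl fun a _ => Finset.sum_congr rfl fun b _ => ?_
      rw [RR_skew H.geo, H.symGi]; ring
    linarith
  have t2 : γ (φ u) (RR Γ (φ u) v w (ξ u)) (ξ u) = 0 := by
    have := RR_skew H.geo (φ u) v w (ξ u) (ξ u)
    linarith
  rw [← sub_eq_zero]
  unfold Rc
  have : ∀ z y, γ (φ u) (RR Γ (φ u) z v w) y = γ (φ u) (RR Γ (φ u) z w v) y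
      - γ (φ u) (RR Γ (φ u) v w z) y := by
    intro z y
    have := congrArg (fun x => γ (φ u) x y) (key z)
    simp only [map_sub, map_neg, sub_apply, neg_apply] at this
    linarith
  simp only [this, mul_sub, Finset.sum_sub_distrib, t, t2]
  ring

lemma Rc1 (u : E) (w : F) :
    Rc Γ γ φ ξ d Gi u (ξ u) w
      = ∑ a, ∑ b, Gi u a b * γ (φ u) (RR Γ (φ u) (fe φ d a u) (ξ u) w) (fe φ d b u) := by
  unfold Rc; rw [RR_self]; simp

lemma Rc2 (H : HyFrm Γ γ φ ξ d Gi) (u : E) (v : F) :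
    Rc Γ γ φ ξ d Gi u v (ξ u)
      = ∑ a, ∑ b, Gi u a b * γ (φ u) (RR Γ (φ u) (fe φ d a u) v (ξ u)) (fe φ d b u) := by
  have t2 : γ (φ u) (RR Γ (φ u) (ξ u) v (ξ u)) (ξ u) = 0 := by
    have := RR_skew H.geo (φ u) (ξ u) v (ξ u) (ξ u)
    linarith
  unfold Rc; rw [t2]; simp

lemma codazzi (H : HyFrm Γ γ φ ξ d Gi) (u : E) (a b c : ι) :
    fderiv ℝ (fun q => hh Γ γ φ ξ d q b c) u (d a)
      = fderiv ℝ (fun q => hh Γ γ φ ξ d q a b) u (d c)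
        - ∑ e, CC Γ γ φ d Gi u e c b * hh Γ γ φ ξ d u a e
        + ∑ e, CC Γ γ φ d Gi u e a b * hh Γ γ φ ξ d u e c
        - γ (φ u) (RR Γ (φ u) (fe φ d a u) (fe φ d c u) (ξ u)) (fe φ d b u) := by
  have h := congrArg (fun x => γ (φ u) x (fe φ d b u)) (DD_comm H.geo H.smφ H.smξ u (d a) (d c))
  simp only [map_add, add_apply, H.N4] at h
  have e1 : (fun q => hh Γ γ φ ξ d q b c) = fun q => hh Γ γ φ ξ d q c b := by
    ext q; exact H.hsymm q b c
  have e2 : ∑ e, CC Γ γ φ d Gi u e a b * hh Γ γ φ ξ d u e c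
    = ∑ e, CC Γ γ φ d Gi u e a b * hh Γ γ φ ξ d u c e :=
    Finset.sum_congr rfl fun e _ => by rw [H.hsymm]
  rw [e1, e2]
  simp only [fe] at h ⊢
  linarith

lemma Qc (H : HyFrm Γ γ φ ξ d Gi) (u : E) (c : ι) :
    ∑ a, ∑ b, Gi u a b * (γ (φ u) (DD Γ φ (DD Γ φ ξ (d b)) (d a) u) (fe φ d c u)
      - ∑ e, CC Γ γ φ d Gi u e a b * γ (φ u) (DD Γ φ ξ (d e) u) (fe φ d c u))
    = - fderiv ℝ (ff Γ γ φ ξ d Gi) u (d c) + Rc Γ γ φ ξ d Gi u (fe φ d c u) (ξ u) := by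
  rw [H.df, H.Rc2]
  simp only [H.dGi, H.N4, H.N2, H.codazzi u _ _ c]
  have e1 : ∀ a, ∑ e, CC Γ γ φ d Gi u e a c = ∑ e, CC Γ γ φ d Gi u e c a :=
    fun a => Finset.sum_congr rfl fun e _ => H.Csymm u a c e
  simp only [H.Csymm u _ c]
  simp only [mul_neg, Finset.sum_neg_distrib, sub_neg_eq_add, neg_sub, neg_mul, mul_add, mul_sub,
    Finset.sum_add_distrib, Finset.sum_sub_distrib, add_mul, Finset.sum_mul, Finset.mul_sum,
    neg_add]
  have s1 : ∑ a, ∑ b, ∑ e, Gi u a b * (CC Γ γ φ d Gi u e c b * hh Γ γ φ ξ d u a e)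
    = ∑ a, ∑ b, ∑ e, Gi u a e * CC Γ γ φ d Gi u b c e * hh Γ γ φ ξ d u a b := by
    refine Finset.sum_congr rfl fun a _ => ?_
    rw [Finset.sum_comm]
    simp only [mul_assoc]
  have s2 : ∑ a, ∑ b, ∑ e, Gi u a b * (CC Γ γ φ d Gi u e c a * hh Γ γ φ ξ d u b e)
    = ∑ a, ∑ b, ∑ e, Gi u e b * CC Γ γ φ d Gi u a c e * hh Γ γ φ ξ d u a b := by
    rw [Finset.sum_comm]
    simp only [Finset.sum_comm (s := Finset.univ) (t := Finset.univ) (f := fun a e =>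
      Gi u a _ * (CC Γ γ φ d Gi u e c a * hh Γ γ φ ξ d u _ e))]
    rw [Finset.sum_comm]
    refine Finset.sum_congr rfl fun a _ => Finset.sum_congr rfl fun b _ =>
      Finset.sum_congr rfl fun e _ => ?_
    rw [H.hsymm u b a]; ring
  rw [← s1, ← s2]
  ring

end HyFrm
end FrameGeo

section FrameBi

set_option linter.unusedSectionVars false

variable {E F ι : Type*} [NormedAddCommGroup E] [NormedSpace ℝ E]
  [NormedAddCommGroup F] [NormedSpace ℝ F] [Fintype ι] [DecidableEq ι]

variable {Γ : F → F →L[ℝ] F →L[ℝ] F} {γ : F → F →L[ℝ] F →L[ℝ] ℝ}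
  {φ ξ : E → F} {d : ι → E} {Gi : E → ι → ι → ℝ}

def ten (Γ : F → F →L[ℝ] F →L[ℝ] F) (γ : F → F →L[ℝ] F →L[ℝ] ℝ)
    (φ : E → F) (d : ι → E) (Gi : E → ι → ι → ℝ) (u : E) : F :=
  ∑ a, ∑ b, Gi u a b • (DD Γ φ (fe φ d b) (d a) u - ∑ c, CC Γ γ φ d Gi u c a b • fe φ d c u)

def bit (Γ : F → F →L[ℝ] F →L[ℝ] F) (γ : F → F →L[ℝ] F →L[ℝ] ℝ)
    (φ : E → F) (d : ι → E) (Gi : E → ι → ι → ℝ) (τ : E → F) (u : E) : F :=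
  ∑ a, ∑ b, Gi u a b • (DD Γ φ (DD Γ φ τ (d b)) (d a) u
    - ∑ c, CC Γ γ φ d Gi u c a b • DD Γ φ τ (d c) u)
  - ∑ a, ∑ b, Gi u a b • RR Γ (φ u) (fe φ d a u) (τ u) (fe φ d b u)

namespace HyFrm

lemma ten_eq (H : HyFrm Γ γ φ ξ d Gi) :
    ten Γ γ φ d Gi = fun u => ff Γ γ φ ξ d Gi u • ξ u := by
  ext u
  unfold ten ff
  simp only [H.De, add_sub_cancel_left, Finset.sum_smul, smul_smul]

lemma DDf (H : HyFrm Γ γ φ ξ d Gi) (b : ι) :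
    DD Γ φ (fun u => ff Γ γ φ ξ d Gi u • ξ u) (d b) = fun u =>
      ff Γ γ φ ξ d Gi u • DD Γ φ ξ (d b) u
        + (fderiv ℝ (ff Γ γ φ ξ d Gi) u (d b)) • ξ u := by
  ext u
  exact DD_smul H.smf H.smξ u (d b)

lemma DDDf (H : HyFrm Γ γ φ ξ d Gi) (u : E) (a b : ι) :
    DD Γ φ (DD Γ φ (fun u => ff Γ γ φ ξ d Gi u • ξ u) (d b)) (d a) u =
      ff Γ γ φ ξ d Gi u • DD Γ φ (DD Γ φ ξ (d b)) (d a) u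
      + (fderiv ℝ (ff Γ γ φ ξ d Gi) u (d a)) • DD Γ φ ξ (d b) u
      + ((fderiv ℝ (ff Γ γ φ ξ d Gi) u (d b)) • DD Γ φ ξ (d a) u
      + (fderiv ℝ (fun q => fderiv ℝ (ff Γ γ φ ξ d Gi) q (d b)) u (d a)) • ξ u) := by
  rw [H.DDf]
  have s := DD_smooth H.geo H.smφ H.smξ (d b)
  have s2 := smooth_fd H.smf (d b)
  have h1 : DD Γ φ (fun u => ff Γ γ φ ξ d Gi u • DD Γ φ ξ (d b) u
      + (fderiv ℝ (ff Γ γ φ ξ d Gi) u (d b)) • ξ u) (d a) u = _ :=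
    DD_add (H.smf.smul s) (s2.smul H.smξ) u (d a)
  rw [h1]
  exact congrArg₂ (· + ·) (DD_smul H.smf s u (d a)) (DD_smul s2 H.smξ u (d a))

lemma nA (H : HyFrm Γ γ φ ξ d Gi) (u : E) :
    ∑ a, ∑ b, Gi u a b * γ (φ u) (DD Γ φ ξ (d b) u) (DD Γ φ ξ (d a) u)
      = ∑ a, ∑ b, (∑ c, Gi u a c * hh Γ γ φ ξ d u c b) * (∑ c, Gi u b c * hh Γ γ φ ξ d u c a) := by
  have e : ∀ a b, γ (φ u) (DD Γ φ ξ (d b) u) (DD Γ φ ξ (d a) u)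
      = ∑ p, ∑ q, Gi u p q * hh Γ γ φ ξ d u a p * hh Γ γ φ ξ d u b q := by
    intro a b
    conv_lhs => rw [H.compl u (DD Γ φ ξ (d a) u)]
    have n2 := H.N2 u
    simp only [fe] at n2
    simp only [map_add, map_sum, map_smul, smul_eq_mul, H.N1, mul_zero, add_zero, n2]
    refine Finset.sum_congr rfl fun p _ => Finset.sum_congr rfl fun q _ => ?_
    ring
  simp only [e, Finset.mul_sum, Finset.sum_mul]
  -- LHS sum a b p q : Gi a b Gi p q h a p h b q
  -- RHS sum a b c e : Gi a e h e b Gi b c h c a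
  have : ∀ T : ι → ι → ι → ι → ℝ, ∑ a, ∑ b, ∑ p, ∑ q, T a b p q
      = ∑ b, ∑ p, ∑ q, ∑ a, T a b p q := by
    intro T
    rw [Finset.sum_comm]
    refine Finset.sum_congr rfl fun b _ => ?_
    rw [Finset.sum_comm]
    refine Finset.sum_congr rfl fun p _ => ?_
    rw [Finset.sum_comm]
  rw [this]
  refine Finset.sum_congr rfl fun b _ => Finset.sum_congr rfl fun p _ =>
    Finset.sum_congr rfl fun q _ => Finset.sum_congr rfl fun a _ => ?_
  rw [H.symGi u a b, H.hsymm u b q]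
  ring

lemma bit_normal (H : HyFrm Γ γ φ ξ d Gi) (u : E) :
    γ (φ u) (bit Γ γ φ d Gi (fun u => ff Γ γ φ ξ d Gi u • ξ u) u) (ξ u)
      = (∑ a, ∑ b, Gi u a b *
          (fderiv ℝ (fun q => fderiv ℝ (ff Γ γ φ ξ d Gi) q (d b)) u (d a)
            - ∑ c, CC Γ γ φ d Gi u c a b * fderiv ℝ (ff Γ γ φ ξ d Gi) u (d c)))
        - ff Γ γ φ ξ d Gi u * (∑ a, ∑ b, (∑ c, Gi u a c * hh Γ γ φ ξ d u c b)
            * (∑ c, Gi u b c * hh Γ γ φ ξ d u c a))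
        + ff Γ γ φ ξ d Gi u * Rc Γ γ φ ξ d Gi u (ξ u) (ξ u) := by
  rw [← H.nA, Rc1]
  unfold bit
  simp only [H.DDDf, RR_lin2]
  simp only [H.DDf]
  simp only [map_add, map_sub, map_sum, map_smul, add_apply, sub_apply, sum_apply, smul_apply,
    smul_eq_mul, H.N1, H.N3, H.unit]
  have e : ∀ a b, γ (φ u) (RR Γ (φ u) (fe φ d a u) (ξ u) (fe φ d b u)) (ξ u)
    = - γ (φ u) (RR Γ (φ u) (fe φ d a u) (ξ u) (ξ u)) (fe φ d b u) :=
    fun a b => RR_skew H.geo _ _ _ _ _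
  simp only [e, Finset.mul_sum, ← Finset.sum_sub_distrib, ← Finset.sum_add_distrib]
  refine Finset.sum_congr rfl fun a _ => Finset.sum_congr rfl fun b _ => ?_
  simp only [mul_zero, zero_add, mul_one]
  ring

lemma bit_tan (H : HyFrm Γ γ φ ξ d Gi) (u : E) (c : ι) :
    γ (φ u) (bit Γ γ φ d Gi (fun u => ff Γ γ φ ξ d Gi u • ξ u) u) (fe φ d c u)
      = - (2 * (∑ b, hh Γ γ φ ξ d u c b * ∑ a, Gi u b a * fderiv ℝ (ff Γ γ φ ξ d Gi) u (d a))
        + ff Γ γ φ ξ d Gi u * fderiv ℝ (ff Γ γ φ ξ d Gi) u (d c)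
        - 2 * ff Γ γ φ ξ d Gi u * Rc Γ γ φ ξ d Gi u (ξ u) (fe φ d c u)) := by
  have q := H.Qc u c
  rw [H.Rcsymm, Rc1] at q
  rw [Rc1]
  have e0 : ∀ c, γ (φ u) (ξ u) (fe φ d c u) = 0 := H.nor u
  have e : ∀ a b, γ (φ u) (RR Γ (φ u) (fe φ d a u) (ξ u) (fe φ d b u)) (fe φ d c u)
    = - γ (φ u) (RR Γ (φ u) (fe φ d a u) (ξ u) (fe φ d c u)) (fe φ d b u) :=
    fun a b => RR_skew H.geo _ _ _ _ _
  have s1 : γ (φ u) (bit Γ γ φ d Gi (fun u => ff Γ γ φ ξ d Gi u • ξ u) u) (fe φ d c u)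
    = ff Γ γ φ ξ d Gi u * (∑ a, ∑ b, Gi u a b *
      (γ (φ u) (DD Γ φ (DD Γ φ ξ (d b)) (d a) u) (fe φ d c u)
      - ∑ e, CC Γ γ φ d Gi u e a b * γ (φ u) (DD Γ φ ξ (d e) u) (fe φ d c u)))
      + (∑ a, ∑ b, Gi u a b * (fderiv ℝ (ff Γ γ φ ξ d Gi) u (d a) * - hh Γ γ φ ξ d u b c))
      + (∑ a, ∑ b, Gi u a b * (fderiv ℝ (ff Γ γ φ ξ d Gi) u (d b) * - hh Γ γ φ ξ d u a c))
      + ff Γ γ φ ξ d Gi u * (∑ a, ∑ b, Gi u a b *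
        γ (φ u) (RR Γ (φ u) (fe φ d a u) (ξ u) (fe φ d c u)) (fe φ d b u)) := by
    unfold bit
    simp only [H.DDDf, RR_lin2]
    simp only [H.DDf]
    simp only [map_add, map_sub, map_sum, map_smul, add_apply, sub_apply, sum_apply, smul_apply,
      smul_eq_mul, e0, e, H.N2]
    simp only [Finset.mul_sum, mul_sub, ← Finset.sum_sub_distrib, ← Finset.sum_add_distrib]
    refine Finset.sum_congr rfl fun a _ => Finset.sum_congr rfl fun b _ => ?_
    have : ∀ x, CC Γ γ φ d Gi u x a b * (ff Γ γ φ ξ d Gi u * -hh Γ γ φ ξ d u x c +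
          fderiv ℝ (ff Γ γ φ ξ d Gi) u (d x) * 0) =
        ff Γ γ φ ξ d Gi u * (CC Γ γ φ d Gi u x a b * -hh Γ γ φ ξ d u x c) := fun x => by ring
    simp only [this, ← Finset.mul_sum]
    ring
  rw [s1, q]
  have t1 : (∑ a, ∑ b, Gi u a b * (fderiv ℝ (ff Γ γ φ ξ d Gi) u (d a) * - hh Γ γ φ ξ d u b c))
    = - ∑ b, hh Γ γ φ ξ d u c b * ∑ a, Gi u b a * fderiv ℝ (ff Γ γ φ ξ d Gi) u (d a) := by
    rw [Finset.sum_comm]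
    simp only [← Finset.sum_neg_distrib, Finset.mul_sum]
    refine Finset.sum_congr rfl fun a _ => Finset.sum_congr rfl fun b _ => ?_
    rw [H.hsymm u a c, H.symGi u a b]; ring
  have t2 : (∑ a, ∑ b, Gi u a b * (fderiv ℝ (ff Γ γ φ ξ d Gi) u (d b) * - hh Γ γ φ ξ d u a c))
    = - ∑ b, hh Γ γ φ ξ d u c b * ∑ a, Gi u b a * fderiv ℝ (ff Γ γ φ ξ d Gi) u (d a) := by
    simp only [← Finset.sum_neg_distrib, Finset.mul_sum]
    refine Finset.sum_congr rfl fun a _ => Finset.sum_congr rfl fun b _ => ?_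
    rw [H.hsymm u a c]; ring
  rw [t1, t2]
  ring

lemma zero_iff (H : HyFrm Γ γ φ ξ d Gi) (u : E) (V : F) :
    V = 0 ↔ γ (φ u) V (ξ u) = 0 ∧ ∀ c, γ (φ u) V (fe φ d c u) = 0 := by
  constructor
  · rintro rfl; simp
  · rintro ⟨h1, h2⟩
    rw [H.compl u V, h1]
    simp only [fe] at h2
    simp [h2]

/-- trace in the frame -/
lemma trace (H : HyFrm Γ γ φ ξ d Gi) (u : E) (v w : F) {κ : Type*} [Fintype κ]
    (ε : κ → F) (cf : κ → F →L[ℝ] ℝ) (hε : ∀ V, V = ∑ k, cf k V • ε k) :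
    ∑ k, cf k (RR Γ (φ u) (ε k) v w) = Rc Γ γ φ ξ d Gi u v w := by
  obtain ⟨L, hL⟩ := RR_lin1 (Γ := Γ) (φ u) v w
  unfold Rc
  simp only [← hL]
  have h1 : ∀ V W, γ (φ u) V W = ∑ k, cf k V * γ (φ u) (ε k) W := by
    intro V W
    conv_lhs => rw [hε V]
    simp
  have h2 : ∀ k, L (ε k) = ∑ a, ∑ b, (Gi u a b * γ (φ u) (ε k) (fe φ d a u)) • L (fe φ d b u)
      + γ (φ u) (ε k) (ξ u) • L (ξ u) := by
    intro k
    conv_lhs => rw [H.compl u (ε k)]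
    simp [fe]
  simp only [h2, map_add, map_sum, map_smul, smul_eq_mul]
  rw [Finset.sum_add_distrib, h1 (L (ξ u))]
  congr 1
  · rw [Finset.sum_comm]
    conv_rhs => rw [Finset.sum_comm]
    refine Finset.sum_congr rfl fun a _ => ?_
    rw [Finset.sum_comm]
    refine Finset.sum_congr rfl fun b _ => ?_
    rw [h1, Finset.mul_sum]
    refine Finset.sum_congr rfl fun k _ => ?_
    rw [H.symGi]; ring
  · refine Finset.sum_congr rfl fun k _ => ?_
    ring

end HyFrm
end FrameBi

section Bridge

lemma smul_const_smooth {E F : Type*} [NormedAddCommGroup E] [NormedSpace ℝ E]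
    [NormedAddCommGroup F] [NormedSpace ℝ F] {f : E → ℝ} (hf : ContDiff ℝ (⊤ : ℕ∞) f) (c : F) :
    ContDiff ℝ (⊤ : ℕ∞) fun q => f q • c := hf.smul contDiff_const

lemma gip_comm {n : ℕ} {g : Met n} (hg : ∀ p i j, g p i j = g p j i) (p v w : Pt n) :
    gip g p v w = gip g p w v := by
  unfold gip
  rw [Finset.sum_comm]
  refine Finset.sum_congr rfl fun a _ => Finset.sum_congr rfl fun b _ => ?_
  rw [hg p b a]; ring

lemma riem_det {n : ℕ} {g : Met n} (hg : IsRiemannian g) (p : Pt n) : (g p).det ≠ 0 := by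
  intro h
  obtain ⟨v, hv, h0⟩ := Matrix.exists_mulVec_eq_zero_iff.2 h
  have h1 := hg.posdef p v hv
  have : gip g p v v = ∑ i, v i * (g p).mulVec v i := by
    unfold gip Matrix.mulVec dotProduct
    simp only [Finset.mul_sum]
    refine Finset.sum_congr rfl fun a _ => Finset.sum_congr rfl fun b _ => ?_
    ring
  rw [this, h0] at h1
  simp at h1

lemma riem_inv_mul {n : ℕ} {g : Met n} (hg : IsRiemannian g) (p : Pt n) : (g p)⁻¹ * g p = 1 :=
  Matrix.nonsing_inv_mul _ (isUnit_iff_ne_zero.2 (riem_det hg p))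

lemma riem_mul_inv {n : ℕ} {g : Met n} (hg : IsRiemannian g) (p : Pt n) : g p * (g p)⁻¹ = 1 :=
  Matrix.mul_nonsing_inv _ (isUnit_iff_ne_zero.2 (riem_det hg p))

lemma det_smooth {n l : ℕ} {M : Pt l → Matrix (Fin n) (Fin n) ℝ}
    (h : ∀ i j, ContDiff ℝ (⊤ : ℕ∞) fun p => M p i j) :
    ContDiff ℝ (⊤ : ℕ∞) fun p => (M p).det := by
  simp only [Matrix.det_apply]
  refine ContDiff.sum fun σ _ => ContDiff.const_smul _ ?_
  exact contDiff_prod fun i _ => h _ _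

lemma inv_smooth {n : ℕ} {g : Met n} (hg : IsRiemannian g) (i j : Fin n) :
    ContDiff ℝ (⊤ : ℕ∞) fun p => (g p)⁻¹ i j := by
  have : (fun p => (g p)⁻¹ i j) = fun p => ((g p).det)⁻¹ * ((g p).updateRow j (Pi.single i 1)).det := by
    ext p
    rw [Matrix.inv_def, Ring.inverse_eq_inv', Matrix.smul_apply, Matrix.adjugate_apply, smul_eq_mul]
  rw [this]
  refine ((det_smooth hg.smooth).inv (riem_det hg)).mul (det_smooth fun a b => ?_)
  by_cases h : a = j
  · subst h; simp only [Matrix.updateRow_self]; exact contDiff_const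
  · simp only [Matrix.updateRow_ne h]; exact hg.smooth a b

lemma inv_symm {n : ℕ} {g : Met n} (hg : IsRiemannian g) (p : Pt n) (i j : Fin n) :
    (g p)⁻¹ i j = (g p)⁻¹ j i := by
  have : (g p).transpose = g p := by ext a b; exact hg.symm p b a
  have h2 := Matrix.transpose_nonsing_inv (g p)
  rw [this] at h2
  conv_lhs => rw [← h2]
  rfl

lemma chr_smooth {n : ℕ} {g : Met n} (hg : IsRiemannian g) (k i j : Fin n) :
    ContDiff ℝ (⊤ : ℕ∞) fun p => christoffel g p k i j := by
  unfold christoffel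
  refine contDiff_const.mul (ContDiff.sum fun l _ => (inv_smooth hg k l).mul ?_)
  exact ((smooth_fd (hg.smooth j l) _).add (smooth_fd (hg.smooth i l) _)).sub
    (smooth_fd (hg.smooth i j) _)

lemma chr_symm {n : ℕ} {g : Met n} (hg : IsRiemannian g) (p : Pt n) (k i j : Fin n) :
    christoffel g p k i j = christoffel g p k j i := by
  unfold christoffel
  congr 1
  refine Finset.sum_congr rfl fun l _ => ?_
  have : (fun q => g q i j) = fun q => g q j i := by ext q; exact hg.symm q i j
  rw [this]; ring

def gC {n : ℕ} (g : Met n) (p : Pt n) : Pt n →L[ℝ] Pt n →L[ℝ] ℝ :=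
  ∑ i, ∑ j, g p i j • (ContinuousLinearMap.proj (R := ℝ) (φ := fun _ : Fin n => ℝ) i).smulRight
    (ContinuousLinearMap.proj (R := ℝ) (φ := fun _ : Fin n => ℝ) j)

def cC {n : ℕ} (g : Met n) (p : Pt n) : Pt n →L[ℝ] Pt n →L[ℝ] Pt n :=
  ∑ k, ∑ i, ∑ j, christoffel g p k i j •
    (ContinuousLinearMap.proj (R := ℝ) (φ := fun _ : Fin n => ℝ) i).smulRight
    ((ContinuousLinearMap.proj (R := ℝ) (φ := fun _ : Fin n => ℝ) j).smulRight
      (Pi.single k (1 : ℝ) : Pt n))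

lemma gC_apply {n : ℕ} (g : Met n) (p v w : Pt n) : gC g p v w = gip g p v w := by
  simp [gC, gip, sum_apply, mul_assoc]

lemma cC_apply {n : ℕ} (g : Met n) (p v w : Pt n) (k : Fin n) :
    cC g p v w k = ∑ i, ∑ j, christoffel g p k i j * v i * w j := by
  simp [cC, sum_apply, Finset.sum_apply, Pi.single_apply, mul_assoc]

lemma chr_low {n : ℕ} {g : Met n} (hg : IsRiemannian g) (p : Pt n) (l i j : Fin n) :
    ∑ k, g p k j * christoffel g p k l i = (1 / 2) *
      (fderiv ℝ (fun q => g q i j) p (Pi.single l 1)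
      + fderiv ℝ (fun q => g q l j) p (Pi.single i 1)
      - fderiv ℝ (fun q => g q l i) p (Pi.single j 1)) := by
  unfold christoffel
  set B : Fin n → ℝ := fun j => (fderiv ℝ (fun q => g q i j) p (Pi.single l 1)
      + fderiv ℝ (fun q => g q l j) p (Pi.single i 1)
      - fderiv ℝ (fun q => g q l i) p (Pi.single j 1)) with hB
  have h : ∀ a, ∑ k, g p k j * (g p)⁻¹ k a = if j = a then 1 else 0 := by
    intro a
    have := congrFun (congrFun (riem_mul_inv hg p) j) a
    rw [Matrix.mul_apply, Matrix.one_apply] at this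
    rw [← this]
    exact Finset.sum_congr rfl fun k _ => by rw [hg.symm]
  change ∑ k, g p k j * (1 / 2 * ∑ l, (g p)⁻¹ k l * B l) = 1 / 2 * B j
  have : ∀ k, g p k j * (1 / 2 * ∑ l, (g p)⁻¹ k l * B l)
      = 1 / 2 * ∑ l, (g p k j * (g p)⁻¹ k l) * B l := by
    intro k
    simp only [Finset.mul_sum]
    exact Finset.sum_congr rfl fun _ _ => by ring
  simp only [this]
  rw [← Finset.mul_sum, Finset.sum_comm]
  simp only [← Finset.sum_mul, h]
  simp

lemma fd_basis {n : ℕ} (f : Pt n → ℝ) (p x : Pt n) :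
    fderiv ℝ f p x = ∑ l, x l * fderiv ℝ f p (Pi.single l 1) := by
  conv_lhs => rw [← Finset.univ_sum_single x]
  rw [map_sum]
  refine Finset.sum_congr rfl fun l _ => ?_
  have : (Pi.single l (x l) : Pt n) = x l • Pi.single l 1 := by
    rw [← Pi.single_smul]; simp
  rw [this, map_smul, smul_eq_mul]

lemma gC_smooth {n : ℕ} {g : Met n} (hg : IsRiemannian g) : ContDiff ℝ (⊤ : ℕ∞) (gC g) := by
  unfold gC
  exact ContDiff.sum fun i _ => ContDiff.sum fun j _ => smul_const_smooth (hg.smooth i j) _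

lemma cC_smooth {n : ℕ} {g : Met n} (hg : IsRiemannian g) : ContDiff ℝ (⊤ : ℕ∞) (cC g) := by
  unfold cC
  exact ContDiff.sum fun k _ => ContDiff.sum fun i _ => ContDiff.sum fun j _ =>
    smul_const_smooth (chr_smooth hg k i j) _

lemma gC_fd {n : ℕ} {g : Met n} (hg : IsRiemannian g) (p x y z : Pt n) :
    fderiv ℝ (gC g) p x y z =
      ∑ l, ∑ i, ∑ j, fderiv ℝ (fun q => g q i j) p (Pi.single l 1) * x l * y i * z j := by
  have h1 := (smooth_diff (gC_smooth hg) p).hasFDerivAt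
  have e : fderiv ℝ (gC g) p x y z = fderiv ℝ (fun q => gC g q y z) p x := by
    rw [((h1.clm_apply (hasFDerivAt_const y p)).clm_apply (hasFDerivAt_const z p)).fderiv]
    simp
  rw [e]
  have h2 : HasFDerivAt (fun q => gC g q y z)
      (∑ i, ∑ j, z j • y i • fderiv ℝ (fun q => g q i j) p) p := by
    simp only [gC_apply, gip]
    refine HasFDerivAt.fun_sum fun i _ => HasFDerivAt.fun_sum fun j _ => ?_
    exact ((smooth_diff (hg.smooth i j) p).hasFDerivAt.mul_const (y i)).mul_const (z j)
  rw [h2.fderiv]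
  simp only [sum_apply, smul_apply, smul_eq_mul]
  conv_rhs => rw [Finset.sum_comm]
  refine Finset.sum_congr rfl fun i _ => ?_
  rw [Finset.sum_comm]
  refine Finset.sum_congr rfl fun j _ => ?_
  rw [fd_basis, Finset.mul_sum, Finset.mul_sum]
  exact Finset.sum_congr rfl fun l _ => by ring

lemma gC_chr {n : ℕ} {g : Met n} (hg : IsRiemannian g) (p x y z : Pt n) :
    gC g p (cC g p x y) z =
      ∑ l, ∑ i, ∑ j, (1 / 2) *
      (fderiv ℝ (fun q => g q i j) p (Pi.single l 1)
      + fderiv ℝ (fun q => g q l j) p (Pi.single i 1)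
      - fderiv ℝ (fun q => g q l i) p (Pi.single j 1)) * x l * y i * z j := by
  simp only [← chr_low hg, gC_apply, gip, cC_apply]
  simp only [Finset.sum_mul, Finset.mul_sum]
  -- LHS: k j l i ; RHS l i j k
  have hT : ∀ T : Fin n → Fin n → Fin n → Fin n → ℝ, ∑ k, ∑ j, ∑ l, ∑ i, T k j l i
      = ∑ l, ∑ i, ∑ j, ∑ k, T k j l i := by
    intro T
    rw [Finset.sum_comm]
    have : ∀ j, ∑ k, ∑ l, ∑ i, T k j l i = ∑ l, ∑ i, ∑ k, T k j l i := by
      intro j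
      rw [Finset.sum_comm]
      exact Finset.sum_congr rfl fun l _ => Finset.sum_comm
    simp only [this]
    rw [Finset.sum_comm]
    exact Finset.sum_congr rfl fun l _ => Finset.sum_comm
  rw [hT]
  refine Finset.sum_congr rfl fun l _ => Finset.sum_congr rfl fun i _ =>
    Finset.sum_congr rfl fun j _ => Finset.sum_congr rfl fun k _ => ?_
  ring

lemma geoC {n : ℕ} {g : Met n} (hg : IsRiemannian g) : Geo (cC g) (gC g) where
  smΓ := cC_smooth hg
  smγ := gC_smooth hg
  symΓ := by
    intro p x y
    ext k
    rw [cC_apply, cC_apply, Finset.sum_comm]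
    refine Finset.sum_congr rfl fun i _ => Finset.sum_congr rfl fun j _ => ?_
    rw [chr_symm hg]; ring
  symγ := by
    intro p x y
    rw [gC_apply, gC_apply, gip_comm hg.symm]
  compat := by
    intro p x y z
    have hs : gC g p y (cC g p x z) = gC g p (cC g p x z) y := by
      rw [gC_apply, gC_apply, gip_comm hg.symm]
    rw [hs, gC_fd hg, gC_chr hg, gC_chr hg, ← Finset.sum_add_distrib]
    refine Finset.sum_congr rfl fun l _ => ?_
    have : ∀ T : Fin n → Fin n → ℝ, ∑ i, ∑ j, T i j = ∑ i, ∑ j, T j i := fun T => Finset.sum_comm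
    conv_rhs => enter [2]; rw [this]
    simp only [← Finset.sum_add_distrib]
    refine Finset.sum_congr rfl fun i _ => Finset.sum_congr rfl fun j _ => ?_
    have e : (fun q => g q j i) = fun q => g q i j := by ext q; exact hg.symm q j i
    rw [e]; ring

lemma fd_comp {l n : ℕ} {V : Pt l → Pt n} (hV : ContDiff ℝ (⊤ : ℕ∞) V) (u a : Pt l) (k : Fin n) :
    fderiv ℝ (fun q => V q k) u a = fderiv ℝ V u a k := by
  have := hasFDerivAt_pi'.1 (smooth_diff hV u).hasFDerivAt k
  rw [this.fderiv]; rfl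

lemma cov_const {n : ℕ} (g : Met n) (v z : Pt n) :
    cov g (fun _ => v) (fun _ => z) = fun p => cC g p v z := by
  ext p k
  simp [cov, cC_apply]

lemma curv_eq {n : ℕ} {g : Met n} (hg : IsRiemannian g) (p v w z : Pt n) :
    curvPt g p v w z = RR (cC g) p v w z := by
  have hl : lieB (fun _ : Pt n => v) (fun _ => w) = fun _ => 0 := by
    ext p k; simp [lieB]
  have h0 : cov g (fun _ => 0) (fun _ => z) p = 0 := by
    rw [cov_const]; simp
  have key : ∀ v w, cov g (fun _ => v) (fun q => cC g q w z) p
      = fderiv ℝ (cC g) p v w z + cC g p v (cC g p w z) := by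
    intro v w
    have h1 := (smooth_diff (cC_smooth hg) p).hasFDerivAt
    have e : fderiv ℝ (cC g) p v w z = fderiv ℝ (fun q => cC g q w z) p v := by
      rw [((h1.clm_apply (hasFDerivAt_const w p)).clm_apply (hasFDerivAt_const z p)).fderiv]
      simp
    have s : ContDiff ℝ (⊤ : ℕ∞) (fun q => cC g q w z) :=
      ((cC_smooth hg).clm_apply contDiff_const).clm_apply contDiff_const
    ext k
    rw [e, Pi.add_apply, ← fd_comp s, cC_apply]
    rfl
  unfold curvPt curvOp
  rw [hl, h0, cov_const, cov_const, key, key]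
  unfold RR
  abel

end Bridge

section Final

def sd {m : ℕ} (a : Fin m) : Pt m := Pi.single a 1

lemma imm_smooth {m n : ℕ} {φ : Pt m → Pt n}
    (h : ∀ k, ContDiff ℝ (⊤ : ℕ∞) fun u => φ u k) : ContDiff ℝ (⊤ : ℕ∞) φ := contDiff_pi.2 h

lemma dmap_eq {m n : ℕ} {φ : Pt m → Pt n} (h : ContDiff ℝ (⊤ : ℕ∞) φ) (u : Pt m) (a : Fin m) :
    dmap φ u a = fe φ sd a u := by
  ext k; exact fd_comp h u _ k

lemma fff_eq {m n : ℕ} {φ : Pt m → Pt n} (g : Met n) (h : ContDiff ℝ (⊤ : ℕ∞) φ) (u : Pt m)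
    (a b : Fin m) : fff g φ u a b = gC g (φ u) (fe φ sd a u) (fe φ sd b u) := by
  unfold fff
  rw [Matrix.of_apply, dmap_eq h, dmap_eq h, gC_apply]

lemma fff_riem {m n : ℕ} {φ : Pt m → Pt n} {g : Met n} (hg : IsRiemannian g)
    (hφ : IsImmersion φ) : IsRiemannian (fff g φ) where
  smooth := by
    intro i j
    have h := imm_smooth hφ.1
    simp only [fff_eq g h]
    exact ip_smooth (geoC hg) h (smooth_fd h _) (smooth_fd h _)
  symm := by
    intro p i j
    have h := imm_smooth hφ.1
    rw [fff_eq g h, fff_eq g h, (geoC hg).symγ]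
  posdef := by
    intro u v hv
    have h := imm_smooth hφ.1
    have e : gip (fff g φ) u v v = gip g (φ u) (∑ a, v a • dmap φ u a) (∑ a, v a • dmap φ u a) := by
      rw [← gC_apply g (φ u)]
      unfold gip
      simp only [fff_eq g h, dmap_eq h, map_sum, map_smul, sum_apply, smul_apply, smul_eq_mul]
      simp only [Finset.mul_sum]
      rw [Finset.sum_comm]
      refine Finset.sum_congr rfl fun a _ => Finset.sum_congr rfl fun b _ => ?_
      ring
    rw [e]
    apply hg.posdef
    intro h0
    have := Fintype.linearIndependent_iff.1 (hφ.2 u) v h0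
    exact hv (funext this)

lemma nondeg {m : ℕ} {g : Met (m + 1)} (hg : IsRiemannian g) {φ ξ : Pt m → Pt (m + 1)}
    (hφ : IsImmersion φ) (hξ : IsUnitNormal g φ ξ) (u : Pt m) (W : Pt (m + 1))
    (h1 : gC g (φ u) W (ξ u) = 0) (h2 : ∀ a, gC g (φ u) W (dmap φ u a) = 0) : W = 0 := by
  have li : LinearIndependent ℝ (Fin.cons (ξ u) (dmap φ u) : Fin (m + 1) → Pt (m + 1)) := by
    rw [linearIndependent_finCons]
    refine ⟨hφ.2 u, fun hmem => ?_⟩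
    have : Submodule.span ℝ (Set.range (dmap φ u)) ≤ LinearMap.ker (gC g (φ u) (ξ u)).toLinearMap := by
      rw [Submodule.span_le]
      rintro _ ⟨a, rfl⟩
      change gC g (φ u) (ξ u) (dmap φ u a) = 0
      rw [gC_apply]; exact hξ.2.2 u a
    have h3 : gC g (φ u) (ξ u) (ξ u) = 0 := this hmem
    rw [gC_apply, hξ.2.1 u] at h3
    exact one_ne_zero h3
  have sp := li.span_eq_top_of_card_eq_finrank (by simp)
  have : Submodule.span ℝ (Set.range (Fin.cons (ξ u) (dmap φ u) : Fin (m + 1) → Pt (m + 1)))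
      ≤ LinearMap.ker (gC g (φ u) W).toLinearMap := by
    rw [Submodule.span_le]
    rintro _ ⟨a, rfl⟩
    refine Fin.cases ?_ (fun a => ?_) a
    · exact h1
    · exact h2 a
  rw [sp] at this
  have h3 : gC g (φ u) W W = 0 := this (Submodule.mem_top (x := W))
  by_contra hne
  have := hg.posdef (φ u) W hne
  rw [gC_apply] at h3
  linarith

lemma hyfrm {m : ℕ} {g : Met (m + 1)} (hg : IsRiemannian g) {φ ξ : Pt m → Pt (m + 1)}
    (hφ : IsImmersion φ) (hξ : IsUnitNormal g φ ξ) :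
    HyFrm (cC g) (gC g) φ ξ sd (fun u a b => (fff g φ u)⁻¹ a b) := by
  have h := imm_smooth hφ.1
  have hr := fff_riem hg hφ
  have inv : ∀ u a c, ∑ b, (fff g φ u)⁻¹ a b *
      gC g (φ u) (fderiv ℝ φ u (sd b)) (fderiv ℝ φ u (sd c)) = if a = c then 1 else 0 := by
    intro u a c
    have := congrFun (congrFun (riem_inv_mul hr u) a) c
    rw [Matrix.mul_apply, Matrix.one_apply] at this
    rw [← this]
    exact Finset.sum_congr rfl fun b _ => by rw [fff_eq g h]; rfl
  have nor : ∀ u a, gC g (φ u) (ξ u) (fderiv ℝ φ u (sd a)) = 0 := by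
    intro u a
    have := hξ.2.2 u a
    rwa [dmap_eq h, ← gC_apply] at this
  refine ⟨geoC hg, h, imm_smooth hξ.1, fun a b => inv_smooth hr a b, inv_symm hr, inv, ?_, nor, ?_⟩
  · intro u; rw [gC_apply]; exact hξ.2.1 u
  · intro u V
    rw [← sub_eq_zero]
    apply nondeg hg hφ hξ u
    · simp only [map_sub, map_add, map_sum, map_smul, sub_apply, add_apply, sum_apply, smul_apply,
        smul_eq_mul, (geoC hg).symγ (φ u) _ (ξ u), nor]
      have : gC g (φ u) (ξ u) (ξ u) = 1 := by rw [gC_apply]; exact hξ.2.1 u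
      rw [this]; simp
    · intro c
      rw [dmap_eq h]
      simp only [map_sub, map_add, map_sum, map_smul, sub_apply, add_apply, sum_apply, smul_apply,
        smul_eq_mul, fe, nor, mul_zero, add_zero]
      have : ∀ a, ∑ b, (fff g φ u)⁻¹ a b * gC g (φ u) V (fderiv ℝ φ u (sd a)) *
          gC g (φ u) (fderiv ℝ φ u (sd b)) (fderiv ℝ φ u (sd c))
          = gC g (φ u) V (fderiv ℝ φ u (sd a)) * if a = c then 1 else 0 := by
        intro a
        rw [← inv u a c, Finset.mul_sum]
        exact Finset.sum_congr rfl fun b _ => by ring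
      simp only [this]
      simp

lemma cov_eq {m n : ℕ} (g : Met n) {φ V : Pt m → Pt n} (h : ContDiff ℝ (⊤ : ℕ∞) φ)
    (hV : ContDiff ℝ (⊤ : ℕ∞) V) (a : Fin m) :
    covAlong g φ V a = DD (cC g) φ V (sd a) := by
  ext u k
  unfold covAlong DD
  rw [Pi.add_apply, cC_apply, fd_comp hV, dmap_eq h]
  rfl

lemma De_eq {m n : ℕ} (g : Met n) {φ : Pt m → Pt n} (h : ContDiff ℝ (⊤ : ℕ∞) φ)
    (u : Pt m) (a b : Fin m) (k : Fin n) :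
    fderiv ℝ (fun q => dmap φ q b k) u (Pi.single a 1)
      + ∑ i, ∑ j, christoffel g (φ u) k i j * dmap φ u a i * dmap φ u b j
    = DD (cC g) φ (fe φ sd b) (sd a) u k := by
  unfold DD
  simp only [dmap_eq h]
  rw [Pi.add_apply, cC_apply, fd_comp (V := fe φ sd b) (smooth_fd h _)]
  rfl

lemma sff_eq {m n : ℕ} (g : Met n) {φ : Pt m → Pt n} (ξ : Pt m → Pt n)
    (h : ContDiff ℝ (⊤ : ℕ∞) φ) (u : Pt m) (a b : Fin m) :
    sff g φ ξ u a b = hh (cC g) (gC g) φ ξ sd u a b := by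
  unfold sff hh
  rw [gC_apply]
  simp only [De_eq g h]

lemma chr_eq {m : ℕ} {g : Met (m + 1)} (hg : IsRiemannian g) {φ ξ : Pt m → Pt (m + 1)}
    (hφ : IsImmersion φ) (hξ : IsUnitNormal g φ ξ) (u : Pt m) (c a b : Fin m) :
    christoffel (fff g φ) u c a b
      = CC (cC g) (gC g) φ sd (fun u a b => (fff g φ u)⁻¹ a b) u c a b := by
  have H := hyfrm hg hφ hξ
  have h := imm_smooth hφ.1
  have dg : ∀ a b c, fderiv ℝ (fun q => fff g φ q a b) u (Pi.single c 1)
      = SS (cC g) (gC g) φ sd u c a b + SS (cC g) (gC g) φ sd u c b a := by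
    intro a b c
    rw [← H.dGm]
    simp only [fff_eq g h]
    rfl
  unfold christoffel CC
  rw [Finset.mul_sum]
  refine Finset.sum_congr rfl fun l _ => ?_
  rw [dg, dg, dg, H.Ssymm u b a l, H.Ssymm u l a b, H.Ssymm u l b a]
  ring

lemma tension_eq {m : ℕ} {g : Met (m + 1)} (hg : IsRiemannian g) {φ ξ : Pt m → Pt (m + 1)}
    (hφ : IsImmersion φ) (hξ : IsUnitNormal g φ ξ) :
    tension g φ = fun u =>
      ff (cC g) (gC g) φ ξ sd (fun u a b => (fff g φ u)⁻¹ a b) u • ξ u := by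
  rw [← (hyfrm hg hφ hξ).ten_eq]
  have h := imm_smooth hφ.1
  ext u k
  unfold tension ten
  simp only [Finset.sum_apply, Pi.smul_apply, Pi.sub_apply, smul_eq_mul]
  refine Finset.sum_congr rfl fun a _ => Finset.sum_congr rfl fun b _ => ?_
  rw [← De_eq g h]
  simp only [chr_eq hg hφ hξ, dmap_eq h]
  ring

lemma bitension_eq {m : ℕ} {g : Met (m + 1)} (hg : IsRiemannian g) {φ ξ : Pt m → Pt (m + 1)}
    (hφ : IsImmersion φ) (hξ : IsUnitNormal g φ ξ) (u : Pt m) :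
    bitension g φ u = bit (cC g) (gC g) φ sd (fun u a b => (fff g φ u)⁻¹ a b)
      (fun u => ff (cC g) (gC g) φ ξ sd (fun u a b => (fff g φ u)⁻¹ a b) u • ξ u) u := by
  have H := hyfrm hg hφ hξ
  have h := imm_smooth hφ.1
  have sτ : ContDiff ℝ (⊤ : ℕ∞) (tension g φ) := by
    rw [tension_eq hg hφ hξ]; exact H.smf.smul H.smξ
  rw [← tension_eq hg hφ hξ]
  ext k
  unfold bitension bit
  simp only [Finset.sum_apply, Pi.smul_apply, Pi.sub_apply, smul_eq_mul, cov_eq g h sτ,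
    cov_eq g h (DD_smooth H.geo h sτ _), chr_eq hg hφ hξ, curv_eq hg, dmap_eq h]

lemma ricci_eq {m : ℕ} {g : Met (m + 1)} (hg : IsRiemannian g) {φ ξ : Pt m → Pt (m + 1)}
    (hφ : IsImmersion φ) (hξ : IsUnitNormal g φ ξ) (u : Pt m) (v w : Pt (m + 1)) :
    ricci g (φ u) v w
      = Rc (cC g) (gC g) φ ξ sd (fun u a b => (fff g φ u)⁻¹ a b) u v w := by
  rw [← (hyfrm hg hφ hξ).trace u v w (fun k : Fin (m + 1) => (Pi.single k (1 : ℝ) : Pt (m + 1)))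
    (fun k => ContinuousLinearMap.proj (R := ℝ) (φ := fun _ : Fin (m + 1) => ℝ) k)]
  · unfold ricci
    simp only [curv_eq hg]
    rfl
  · intro V
    ext k
    simp [Finset.sum_apply, Pi.single_apply]

end Final

/-- Theorem 1.1. An isometric immersion `φ : Mᵐ → N^{m+1}` of
codimension one, with unit normal `ξ`, shape operator `A`, mean curvature `H`
(so the mean curvature vector is `η = Hξ`), is biharmonic if and only if
`ΔH − H|A|² + H Ric^N(ξ,ξ) = 0` and
`2A(grad H) + (m/2) grad H² − 2H (Ric^N(ξ))^⊤ = 0`,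
where `(·)^⊤` is the tangential component along `M`, expressed here through the
induced metric `G = fff g φ` : `(Ric^N(ξ))^{⊤,a} = G^{ab} Ric^N(ξ, dφ(∂_b))`. -/
theorem biharmonic_hypersurface_equation
    (m : ℕ) (hm : 0 < m) (g : Met (m + 1)) (hg : IsRiemannian g)
    (φ ξ : Pt m → Pt (m + 1)) (hφ : IsImmersion φ) (hξ : IsUnitNormal g φ ξ) :
    IsBiharmonic g φ ↔
      ∀ u : Pt m,
        (lapBel (fff g φ) (meanCurv g φ ξ) u
            - meanCurv g φ ξ u * normA2 g φ ξ u
            + meanCurv g φ ξ u * ricci g (φ u) (ξ u) (ξ u) = 0) ∧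
        ∀ a : Fin m,
          2 * (∑ b, shapeOp g φ ξ u a b * gradS (fff g φ) (meanCurv g φ ξ) u b)
            + ((m : ℝ) / 2) * gradS (fff g φ) (fun v => meanCurv g φ ξ v ^ 2) u a
            - 2 * meanCurv g φ ξ u *
                (∑ b, (fff g φ u)⁻¹ a b * ricci g (φ u) (ξ u) (dmap φ u b)) = 0 := by
  have H := hyfrm hg hφ hξ
  have h := imm_smooth hφ.1
  have hr := fff_riem hg hφ
  have hm' : (m : ℝ) ≠ 0 := by exact_mod_cast hm.ne'
  have hbi : IsBiharmonic g φ ↔ ∀ u, bitension g φ u = 0 := Iff.rfl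
  rw [hbi]
  refine forall_congr' fun u => ?_
  rw [bitension_eq hg hφ hξ, H.zero_iff u, H.bit_normal]
  simp only [H.bit_tan]
  set I : Pt m → Fin m → Fin m → ℝ := fun u a b => (fff g φ u)⁻¹ a b with hI
  set f := ff (cC g) (gC g) φ ξ sd I with hf
  have hA : ∀ u a b, shapeOp g φ ξ u a b = ∑ c, I u a c * hh (cC g) (gC g) φ ξ sd u c b := by
    intro u a b
    unfold shapeOp
    exact Finset.sum_congr rfl fun c _ => by rw [sff_eq g ξ h]
  have hH : meanCurv g φ ξ = fun u => (1 / (m : ℝ)) * f u := by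
    ext u
    unfold meanCurv
    congr 1
    simp only [hA, hf, ff]
    exact Finset.sum_congr rfl fun a _ => Finset.sum_congr rfl fun c _ => by rw [H.hsymm]
  have hdH : ∀ u, fderiv ℝ (meanCurv g φ ξ) u = (1 / (m : ℝ)) • fderiv ℝ f u := by
    intro u
    rw [hH]
    exact fderiv_const_mul (smooth_diff H.smf u) _
  have hdH2 : ∀ u, fderiv ℝ (fun v => meanCurv g φ ξ v ^ 2) u
      = (2 * (1 / (m : ℝ)) * (1 / (m : ℝ)) * f u) • fderiv ℝ f u := by
    intro u
    have := ((smooth_diff H.smf u).hasFDerivAt.const_mul (1 / (m : ℝ))).pow 2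
    have e : (fun v => meanCurv g φ ξ v ^ 2) = fun v => ((1 / (m : ℝ)) * f v) ^ 2 := by
      rw [hH]
    rw [e, this.fderiv]
    ext x
    simp
    ring
  have hlap : lapBel (fff g φ) (meanCurv g φ ξ) u = (1 / (m : ℝ)) * ∑ a, ∑ b, I u a b *
      (fderiv ℝ (fun q => fderiv ℝ f q (sd b)) u (sd a)
        - ∑ c, CC (cC g) (gC g) φ sd I u c a b * fderiv ℝ f u (sd c)) := by
    unfold lapBel
    rw [Finset.mul_sum]
    refine Finset.sum_congr rfl fun a _ => ?_
    rw [Finset.mul_sum]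
    refine Finset.sum_congr rfl fun b _ => ?_
    simp only [hdH, chr_eq hg hφ hξ, smul_apply, smul_eq_mul]
    have e : fderiv ℝ (fun q => 1 / (m : ℝ) * fderiv ℝ f q (Pi.single b 1)) u
        = (1 / (m : ℝ)) • fderiv ℝ (fun q => fderiv ℝ f q (sd b)) u :=
      fderiv_const_mul (smooth_diff (smooth_fd H.smf (sd b)) u) _
    rw [e]
    have e2 : ∑ c, CC (cC g) (gC g) φ sd I u c a b * (1 / (m : ℝ) * fderiv ℝ f u (Pi.single c 1))
        = 1 / (m : ℝ) * ∑ c, CC (cC g) (gC g) φ sd I u c a b * fderiv ℝ f u (sd c) := by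
      rw [Finset.mul_sum]
      exact Finset.sum_congr rfl fun c _ => by unfold sd; ring
    rw [e2]
    simp only [smul_apply, smul_eq_mul, sd, hI]
    ring
  have hMu : meanCurv g φ ξ u = (1 / (m : ℝ)) * f u := by rw [hH]
  refine and_congr ?_ ?_
  · rw [hlap, hMu, ricci_eq hg hφ hξ]
    have hn : normA2 g φ ξ u = ∑ a, ∑ b, (∑ c, I u a c * hh (cC g) (gC g) φ ξ sd u c b)
            * (∑ c, I u b c * hh (cC g) (gC g) φ ξ sd u c a) := by
      unfold normA2; simp only [hA]
    rw [hn]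
    have : ∀ x y z : ℝ, x - y + z = 0 ↔ (1 / (m : ℝ)) * x - (1 / (m : ℝ)) * y
        + (1 / (m : ℝ)) * z = 0 := by
      intro x y z
      rw [← mul_sub, ← mul_add, mul_eq_zero]
      simp [hm']
    rw [this]
    simp only [mul_assoc]
    rfl
  · set X : Fin m → ℝ := fun c => 2 * (∑ b, hh (cC g) (gC g) φ ξ sd u c b *
      ∑ a, I u b a * fderiv ℝ f u (sd a)) + f u * fderiv ℝ f u (sd c)
        - 2 * f u * Rc (cC g) (gC g) φ ξ sd I u (ξ u) (fe φ sd c u) with hX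
    have key : ∀ a, 2 * (∑ b, shapeOp g φ ξ u a b * gradS (fff g φ) (meanCurv g φ ξ) u b)
            + ((m : ℝ) / 2) * gradS (fff g φ) (fun v => meanCurv g φ ξ v ^ 2) u a
            - 2 * meanCurv g φ ξ u *
                (∑ b, (fff g φ u)⁻¹ a b * ricci g (φ u) (ξ u) (dmap φ u b))
        = (1 / (m : ℝ)) * ((fff g φ u)⁻¹.mulVec X a) := by
      intro a
      have k1 : ∑ b, shapeOp g φ ξ u a b * gradS (fff g φ) (meanCurv g φ ξ) u b
          = (1 / (m : ℝ)) * ∑ c, I u a c * ∑ b, hh (cC g) (gC g) φ ξ sd u c b *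
            ∑ e, I u b e * fderiv ℝ f u (sd e) := by
        have k0 : ∀ b, gradS (fff g φ) (meanCurv g φ ξ) u b
            = (1 / (m : ℝ)) * ∑ e, I u b e * fderiv ℝ f u (sd e) := by
          intro b
          unfold gradS
          rw [Finset.mul_sum]
          refine Finset.sum_congr rfl fun e _ => ?_
          rw [hdH]
          simp only [smul_apply, smul_eq_mul, sd, hI]
          ring
        simp only [k0, hA]
        generalize hY : (fun b => ∑ e, I u b e * fderiv ℝ f u (sd e)) = Y
        have hY' : ∀ b, ∑ e, I u b e * fderiv ℝ f u (sd e) = Y b := fun b => by rw [← hY]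
        simp only [hY', Finset.mul_sum, Finset.sum_mul]
        rw [Finset.sum_comm]
        refine Finset.sum_congr rfl fun c _ => Finset.sum_congr rfl fun b _ => ?_
        ring
      have k2 : gradS (fff g φ) (fun v => meanCurv g φ ξ v ^ 2) u a
          = (2 * (1 / (m : ℝ)) * (1 / (m : ℝ))) * ∑ c, I u a c * (f u * fderiv ℝ f u (sd c)) := by
        unfold gradS
        rw [Finset.mul_sum]
        refine Finset.sum_congr rfl fun e _ => ?_
        rw [hdH2]
        simp only [smul_apply, smul_eq_mul, sd, hI]
        ring
      have k3 : ∑ b, (fff g φ u)⁻¹ a b * ricci g (φ u) (ξ u) (dmap φ u b)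
          = ∑ c, I u a c * Rc (cC g) (gC g) φ ξ sd I u (ξ u) (fe φ sd c u) := by
        refine Finset.sum_congr rfl fun e _ => ?_
        rw [ricci_eq hg hφ hξ, dmap_eq h]
      have k4 : (fff g φ u)⁻¹.mulVec X a = 2 * (∑ c, I u a c *
          ∑ b, hh (cC g) (gC g) φ ξ sd u c b * ∑ e, I u b e * fderiv ℝ f u (sd e))
          + (∑ c, I u a c * (f u * fderiv ℝ f u (sd c)))
          - 2 * f u * ∑ c, I u a c * Rc (cC g) (gC g) φ ξ sd I u (ξ u) (fe φ sd c u) := by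
        rw [Finset.mul_sum, Finset.mul_sum, ← Finset.sum_add_distrib, ← Finset.sum_sub_distrib]
        unfold Matrix.mulVec dotProduct
        refine Finset.sum_congr rfl fun e _ => ?_
        simp only [hX, hI]
        ring
      rw [k1, k2, k3, k4, hMu]
      have k5 : (m : ℝ) / 2 * (2 * (1 / (m : ℝ)) * (1 / (m : ℝ))) = 1 / (m : ℝ) := by
        field_simp
      linear_combination (∑ c, I u a c * (f u * fderiv ℝ f u (sd c))) * k5
    simp only [key]
    have hz : ∀ c, (- X c = 0 ↔ X c = 0) := fun c => neg_eq_zero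
    have hz2 : ∀ y : ℝ, (1 / (m : ℝ)) * y = 0 ↔ y = 0 := by
      intro y; rw [mul_eq_zero]; simp [hm']
    simp only [hz2]
    change (∀ c, - X c = 0) ↔ _
    simp only [hz]
    constructor
    · intro h0 a
      have : X = 0 := funext h0
      rw [this]; simp
    · intro h0
      have h1 : (fff g φ u)⁻¹.mulVec X = 0 := funext h0
      have h2 : (fff g φ u).mulVec ((fff g φ u)⁻¹.mulVec X) = X := by
        rw [Matrix.mulVec_mulVec, riem_mul_inv hr, Matrix.one_mulVec]
      rw [h1] at h2
      intro c
      rw [← h2]; simp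
end
end

section
/- Let π: M³_{m,l} → (ℝ², h = (dx²+dy²)/[1+m(x²+y²)]²), π(x,y,z) = (x,y), be the Riemannian submersion from a Bianchi–Cartan–Vranceanu space, and let α: I → (ℝ², h) be an immersed regular curve parametrized by arclength. Then the Hopf cylinder Σ = ∪_{s∈I} π^{-1}(α(s)) is a proper biharmonic surface if and only if it is a part of: (1) S¹(1/(2√(2m))) × ℝ in S²(1/(2√m)) × ℝ; or (2) a Hopf cylinder in SU(2) with 4m − l² > 0 over a circle of radius R = 1/√(8m − l²) in the base sphere S²(1/(2√m)) identified with (ℝ², h). -/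
/-!
Coordinate-based Riemannian geometry on charts `ℝⁿ`, enough to express mean
curvature, second fundamental forms, curvature tensors and the (bi)tension
fields of isometric immersions, as used in
"Constant mean curvature and totally umbilical biharmonic surfaces in
3-dimensional geometries".
-/

noncomputable section

open scoped BigOperators

theorem aux_fd {n : ℕ} (i j : Fin n) (m k a b e0 e1 e2 e3 : ℝ) (p v : Pt n)
    (hF : 1 + m * (p i ^ 2 + p j ^ 2) ≠ 0) :
    DifferentiableAt ℝ (fun q : Pt n => k + (a * q i + b * q j) / (1 + m * (q i ^ 2 + q j ^ 2))
      + (e0 + e1 * q i ^ 2 + e2 * (q i * q j) + e3 * q j ^ 2) / (1 + m * (q i ^ 2 + q j ^ 2)) ^ 2) p ∧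
    fderiv ℝ (fun q : Pt n => k + (a * q i + b * q j) / (1 + m * (q i ^ 2 + q j ^ 2))
      + (e0 + e1 * q i ^ 2 + e2 * (q i * q j) + e3 * q j ^ 2) / (1 + m * (q i ^ 2 + q j ^ 2)) ^ 2) p v
    = (a * v i + b * v j) / (1 + m * (p i ^ 2 + p j ^ 2))
      - (a * p i + b * p j) * (2 * m * (p i * v i + p j * v j)) / (1 + m * (p i ^ 2 + p j ^ 2)) ^ 2
      + (2 * e1 * p i * v i + e2 * (v i * p j + p i * v j) + 2 * e3 * p j * v j)
          / (1 + m * (p i ^ 2 + p j ^ 2)) ^ 2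
      - 2 * (e0 + e1 * p i ^ 2 + e2 * (p i * p j) + e3 * p j ^ 2)
          * (2 * m * (p i * v i + p j * v j)) / (1 + m * (p i ^ 2 + p j ^ 2)) ^ 3 := by
  have hd : DifferentiableAt ℝ (fun q : Pt n => k + (a * q i + b * q j) / (1 + m * (q i ^ 2 + q j ^ 2))
      + (e0 + e1 * q i ^ 2 + e2 * (q i * q j) + e3 * q j ^ 2) / (1 + m * (q i ^ 2 + q j ^ 2)) ^ 2) p := by
    have h2 : (1 + m * (p i ^ 2 + p j ^ 2)) ^ 2 ≠ 0 := pow_ne_zero _ hF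
    fun_prop (disch := assumption)
  refine ⟨hd, ?_⟩
  rw [← hd.lineDeriv_eq_fderiv]
  apply HasDerivAt.deriv
  have hi : HasDerivAt (fun t : ℝ => (p + t • v) i) (v i) 0 := by
    simpa using ((hasDerivAt_id (0:ℝ)).mul_const (v i)).const_add (p i)
  have hj : HasDerivAt (fun t : ℝ => (p + t • v) j) (v j) 0 := by
    simpa using ((hasDerivAt_id (0:ℝ)).mul_const (v j)).const_add (p j)
  have hFd := ((((hi.pow 2).add (hj.pow 2)).const_mul m).const_add 1)
  have h0 : 1 + m * (((p + (0:ℝ) • v) i) ^ 2 + ((p + (0:ℝ) • v) j) ^ 2) ≠ 0 := by simpa using hF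
  have hL := (((hi.const_mul a).add (hj.const_mul b)).div hFd h0).const_add k
  have hQ := ((((hi.pow 2).const_mul e1).const_add e0).add ((hi.mul hj).const_mul e2)).add
    ((hj.pow 2).const_mul e3)
  have := hL.add (hQ.div (hFd.pow 2) (pow_ne_zero 2 h0))
  refine HasDerivAt.congr_deriv this ?_
  simp
  field_simp
  ring

theorem aux_fd' {n : ℕ} (i j : Fin n) (m k a b e0 e1 e2 e3 : ℝ) (f : Pt n → ℝ) (p v : Pt n)
    (hF : 1 + m * (p i ^ 2 + p j ^ 2) ≠ 0)
    (hf : ∀ᶠ q in nhds p, f q = k + (a * q i + b * q j) / (1 + m * (q i ^ 2 + q j ^ 2))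
      + (e0 + e1 * q i ^ 2 + e2 * (q i * q j) + e3 * q j ^ 2) / (1 + m * (q i ^ 2 + q j ^ 2)) ^ 2) :
    fderiv ℝ f p v
    = (a * v i + b * v j) / (1 + m * (p i ^ 2 + p j ^ 2))
      - (a * p i + b * p j) * (2 * m * (p i * v i + p j * v j)) / (1 + m * (p i ^ 2 + p j ^ 2)) ^ 2
      + (2 * e1 * p i * v i + e2 * (v i * p j + p i * v j) + 2 * e3 * p j * v j)
          / (1 + m * (p i ^ 2 + p j ^ 2)) ^ 2
      - 2 * (e0 + e1 * p i ^ 2 + e2 * (p i * p j) + e3 * p j ^ 2)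
          * (2 * m * (p i * v i + p j * v j)) / (1 + m * (p i ^ 2 + p j ^ 2)) ^ 3 := by
  rw [Filter.EventuallyEq.fderiv_eq hf]
  exact (aux_fd i j m k a b e0 e1 e2 e3 p v hF).2

theorem aux_ev {n : ℕ} (i j : Fin n) (m : ℝ) (p : Pt n) (hF : 1 + m * (p i ^ 2 + p j ^ 2) ≠ 0) :
    ∀ᶠ q in nhds p, 1 + m * (q i ^ 2 + q j ^ 2) ≠ 0 := by
  have : ContinuousAt (fun q : Pt n => 1 + m * (q i ^ 2 + q j ^ 2)) p := by fun_prop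
  exact this.eventually_ne hF

/-- inverse metric -/
theorem bcv_inv (m l : ℝ) (p : Pt 3) (hF : bcvF m p ≠ 0) :
    (bcvMet m l p)⁻¹ = !![bcvF m p ^ 2, 0, -(bcvF m p * l * p 1 / 2);
      0, bcvF m p ^ 2, bcvF m p * l * p 0 / 2;
      -(bcvF m p * l * p 1 / 2), bcvF m p * l * p 0 / 2, 1 + l ^ 2 * (p 0 ^ 2 + p 1 ^ 2) / 4] := by
  apply Matrix.inv_eq_right_inv
  ext i j
  fin_cases i <;> fin_cases j <;>
    simp [bcvMet, bcvω, Matrix.mul_apply, Fin.sum_univ_three] <;> field_simp <;> ring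

/-- coefficients of metric entries -/
theorem bcv_fd (m l : ℝ) (p v : Pt 3) (hF : bcvF m p ≠ 0) :
    (∀ i j, fderiv ℝ (fun q => bcvMet m l q i j) p v =
      (!![2 * (l^2/4) * p 1 * v 1 / bcvF m p ^ 2 - 2 * (1 + l^2/4 * p 1 ^ 2) * (2 * m * (p 0 * v 0 + p 1 * v 1)) / bcvF m p ^ 3,
         -(l^2/4) * (v 0 * p 1 + p 0 * v 1) / bcvF m p ^ 2 + 2 * (l^2/4 * (p 0 * p 1)) * (2 * m * (p 0 * v 0 + p 1 * v 1)) / bcvF m p ^ 3,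
         l / 2 * v 1 / bcvF m p - l / 2 * p 1 * (2 * m * (p 0 * v 0 + p 1 * v 1)) / bcvF m p ^ 2;
         -(l^2/4) * (v 0 * p 1 + p 0 * v 1) / bcvF m p ^ 2 + 2 * (l^2/4 * (p 0 * p 1)) * (2 * m * (p 0 * v 0 + p 1 * v 1)) / bcvF m p ^ 3,
         2 * (l^2/4) * p 0 * v 0 / bcvF m p ^ 2 - 2 * (1 + l^2/4 * p 0 ^ 2) * (2 * m * (p 0 * v 0 + p 1 * v 1)) / bcvF m p ^ 3,
         -(l / 2) * v 0 / bcvF m p + l / 2 * p 0 * (2 * m * (p 0 * v 0 + p 1 * v 1)) / bcvF m p ^ 2;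
         l / 2 * v 1 / bcvF m p - l / 2 * p 1 * (2 * m * (p 0 * v 0 + p 1 * v 1)) / bcvF m p ^ 2,
         -(l / 2) * v 0 / bcvF m p + l / 2 * p 0 * (2 * m * (p 0 * v 0 + p 1 * v 1)) / bcvF m p ^ 2,
         0] : Matrix (Fin 3) (Fin 3) ℝ) i j) := by
  intro i j
  have hev := aux_ev 0 1 m p hF
  have key := fun k a b e0 e1 e2 e3 f hf => aux_fd' 0 1 m k a b e0 e1 e2 e3 f p v hF hf
  fin_cases i <;> fin_cases j
  · rw [key 0 0 0 1 0 0 (l^2/4)]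
    · simp [bcvF]
    · filter_upwards [hev] with q hq
      simp [bcvMet, bcvω, bcvF]; field_simp; try ring
  · rw [key 0 0 0 0 0 (-(l^2/4)) 0]
    · simp [bcvF]; ring
    · filter_upwards [hev] with q hq
      simp [bcvMet, bcvω, bcvF]; field_simp; try ring
  · rw [key 0 0 (l/2) 0 0 0 0]
    · simp [bcvF]
    · filter_upwards [hev] with q hq
      simp [bcvMet, bcvω, bcvF]; field_simp; try ring
  · rw [key 0 0 0 0 0 (-(l^2/4)) 0]
    · simp [bcvF]; ring
    · filter_upwards [hev] with q hq
      simp [bcvMet, bcvω, bcvF]; field_simp; try ring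
  · rw [key 0 0 0 1 (l^2/4) 0 0]
    · simp [bcvF]
    · filter_upwards [hev] with q hq
      simp [bcvMet, bcvω, bcvF]; field_simp; try ring
  · rw [key 0 (-(l/2)) 0 0 0 0 0]
    · simp [bcvF]; ring
    · filter_upwards [hev] with q hq
      simp [bcvMet, bcvω, bcvF]; field_simp; try ring
  · rw [key 0 0 (l/2) 0 0 0 0]
    · simp [bcvF]
    · filter_upwards [hev] with q hq
      simp [bcvMet, bcvω, bcvF]; field_simp; try ring
  · rw [key 0 (-(l/2)) 0 0 0 0 0]
    · simp [bcvF]; ring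
    · filter_upwards [hev] with q hq
      simp [bcvMet, bcvω, bcvF]; field_simp; try ring
  · rw [key 1 0 0 0 0 0 0]
    · simp [bcvF]
    · filter_upwards [hev] with q hq
      simp [bcvMet, bcvω, bcvF]

/-- explicit Christoffel symbols -/
def Gm (m l : ℝ) (p : Pt 3) : Fin 3 → Matrix (Fin 3) (Fin 3) ℝ :=
  ![!![-(2*m*p 0/bcvF m p), (l^2-8*m)*p 1/(4*bcvF m p), 0;
       (l^2-8*m)*p 1/(4*bcvF m p), (4*m-l^2)*p 0/(2*bcvF m p), l/2;
       0, l/2, 0],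
    !![(4*m-l^2)*p 1/(2*bcvF m p), (l^2-8*m)*p 0/(4*bcvF m p), -(l/2);
       (l^2-8*m)*p 0/(4*bcvF m p), -(2*m*p 1/bcvF m p), 0;
       -(l/2), 0, 0],
    !![l*(4*m-l^2)*p 0*p 1/(4*bcvF m p^2), l*(l^2-4*m)*(p 0^2-p 1^2)/(8*bcvF m p^2), -(l^2*p 0/(4*bcvF m p));
       l*(l^2-4*m)*(p 0^2-p 1^2)/(8*bcvF m p^2), -(l*(4*m-l^2)*p 0*p 1/(4*bcvF m p^2)), -(l^2*p 1/(4*bcvF m p));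
       -(l^2*p 0/(4*bcvF m p)), -(l^2*p 1/(4*bcvF m p)), 0]]

theorem bcv_christoffel (m l : ℝ) (p : Pt 3) (hF : bcvF m p ≠ 0) (k i j : Fin 3) :
    christoffel (bcvMet m l) p k i j = Gm m l p k i j := by
  unfold christoffel
  simp only [bcv_fd m l p _ hF, bcv_inv m l p hF, Fin.sum_univ_three]
  have hF' := hF
  unfold bcvF at hF'
  fin_cases k <;> fin_cases i <;> fin_cases j <;>
    simp [Gm] <;> field_simp <;> (try simp only [bcvF]) <;> (try ring)

def Gb (m l : ℝ) (p w z : Pt 3) : Pt 3 := fun k => ∑ i, ∑ j, Gm m l p k i j * w i * z j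

theorem Gb0 (m l : ℝ) (p w z : Pt 3) : Gb m l p w z 0 =
    l / 2 * (w 1 * z 2 + w 2 * z 1) + ((-(2*m*(w 0 * z 0)) + (4*m-l^2)/2 * (w 1 * z 1)) * p 0
      + ((l^2-8*m)/4 * (w 0 * z 1 + w 1 * z 0)) * p 1) / bcvF m p := by
  simp [Gb, Gm, Fin.sum_univ_three]; ring

theorem Gb1 (m l : ℝ) (p w z : Pt 3) : Gb m l p w z 1 =
    -(l / 2 * (w 0 * z 2 + w 2 * z 0)) + (((l^2-8*m)/4 * (w 0 * z 1 + w 1 * z 0)) * p 0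
      + ((4*m-l^2)/2 * (w 0 * z 0) - 2*m*(w 1 * z 1)) * p 1) / bcvF m p := by
  simp [Gb, Gm, Fin.sum_univ_three]; ring

theorem Gb2 (m l : ℝ) (p w z : Pt 3) : Gb m l p w z 2 =
    (-(l^2/4 * (w 0 * z 2 + w 2 * z 0)) * p 0 + -(l^2/4 * (w 1 * z 2 + w 2 * z 1)) * p 1) / bcvF m p
    + (l*(l^2-4*m)/8*(w 0 * z 1 + w 1 * z 0) * p 0 ^ 2 + l*(4*m-l^2)/4*(w 0 * z 0 - w 1 * z 1) * (p 0 * p 1)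
      + -(l*(l^2-4*m)/8*(w 0 * z 1 + w 1 * z 0)) * p 1 ^ 2) / bcvF m p ^ 2 := by
  simp [Gb, Gm, Fin.sum_univ_three]; ring

theorem bcv_cov (m l : ℝ) (p : Pt 3) (hF : bcvF m p ≠ 0) (X Y : VF 3) (k : Fin 3) :
    cov (bcvMet m l) X Y p k = fderiv ℝ (fun q => Y q k) p (X p) + Gb m l p (X p) (Y p) k := by
  simp only [cov, Gb, bcv_christoffel m l p hF]

theorem bcv_curv (m l : ℝ) (p : Pt 3) (hF : bcvF m p ≠ 0) (v w z : Pt 3) (k : Fin 3) :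
    curvPt (bcvMet m l) p v w z k =
      fderiv ℝ (fun q => Gb m l q w z k) p v - fderiv ℝ (fun q => Gb m l q v z k) p w
      + Gb m l p v (Gb m l p w z) k - Gb m l p w (Gb m l p v z) k := by
  have hc : ∀ (w z : Pt 3) (q : Pt 3), bcvF m q ≠ 0 →
      cov (bcvMet m l) (fun _ => w) (fun _ => z) q = Gb m l q w z := by
    intro w z q hq
    ext k
    rw [bcv_cov m l q hq]
    simp
  have he : ∀ w z : Pt 3, (fun q => cov (bcvMet m l) (fun _ => w) (fun _ => z) q k) =ᶠ[nhds p]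
      fun q => Gb m l q w z k := by
    intro w z
    filter_upwards [aux_ev 0 1 m p hF] with q hq
    rw [hc w z q hq]
  simp only [curvPt, curvOp, Pi.sub_apply]
  rw [bcv_cov m l p hF, bcv_cov m l p hF, bcv_cov m l p hF, (he w z).fderiv_eq, (he v z).fderiv_eq,
    hc w z p hF, hc v z p hF]
  have hl : lieB (fun _ => v) (fun _ => w) p = 0 := by
    ext k; simp [lieB]
  rw [hl]
  have : Gb m l p 0 z k = 0 := by simp [Gb]
  simp [this]
  ring

theorem fdGb0 (m l : ℝ) (p v w z : Pt 3) (hF : bcvF m p ≠ 0) :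
    fderiv ℝ (fun q => Gb m l q w z 0) p v =
    ((-(2*m*(w 0 * z 0)) + (4*m-l^2)/2 * (w 1 * z 1)) * v 0
      + ((l^2-8*m)/4 * (w 0 * z 1 + w 1 * z 0)) * v 1) / bcvF m p
    - ((-(2*m*(w 0 * z 0)) + (4*m-l^2)/2 * (w 1 * z 1)) * p 0
      + ((l^2-8*m)/4 * (w 0 * z 1 + w 1 * z 0)) * p 1) * (2 * m * (p 0 * v 0 + p 1 * v 1)) / bcvF m p ^ 2 := by
  rw [aux_fd' 0 1 m (l / 2 * (w 1 * z 2 + w 2 * z 1)) (-(2*m*(w 0 * z 0)) + (4*m-l^2)/2 * (w 1 * z 1))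
    ((l^2-8*m)/4 * (w 0 * z 1 + w 1 * z 0)) 0 0 0 0 _ p v hF]
  · simp [bcvF]
  · filter_upwards with q
    rw [Gb0]; simp [bcvF]

theorem fdGb1 (m l : ℝ) (p v w z : Pt 3) (hF : bcvF m p ≠ 0) :
    fderiv ℝ (fun q => Gb m l q w z 1) p v =
    (((l^2-8*m)/4 * (w 0 * z 1 + w 1 * z 0)) * v 0
      + ((4*m-l^2)/2 * (w 0 * z 0) - 2*m*(w 1 * z 1)) * v 1) / bcvF m p
    - (((l^2-8*m)/4 * (w 0 * z 1 + w 1 * z 0)) * p 0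
      + ((4*m-l^2)/2 * (w 0 * z 0) - 2*m*(w 1 * z 1)) * p 1) * (2 * m * (p 0 * v 0 + p 1 * v 1)) / bcvF m p ^ 2 := by
  rw [aux_fd' 0 1 m (-(l / 2 * (w 0 * z 2 + w 2 * z 0))) ((l^2-8*m)/4 * (w 0 * z 1 + w 1 * z 0))
    ((4*m-l^2)/2 * (w 0 * z 0) - 2*m*(w 1 * z 1)) 0 0 0 0 _ p v hF]
  · simp [bcvF]
  · filter_upwards with q
    rw [Gb1]; simp [bcvF]

theorem fdGb2 (m l : ℝ) (p v w z : Pt 3) (hF : bcvF m p ≠ 0) :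
    fderiv ℝ (fun q => Gb m l q w z 2) p v =
    (-(l^2/4 * (w 0 * z 2 + w 2 * z 0)) * v 0 + -(l^2/4 * (w 1 * z 2 + w 2 * z 1)) * v 1) / bcvF m p
    - (-(l^2/4 * (w 0 * z 2 + w 2 * z 0)) * p 0 + -(l^2/4 * (w 1 * z 2 + w 2 * z 1)) * p 1)
       * (2 * m * (p 0 * v 0 + p 1 * v 1)) / bcvF m p ^ 2
    + (2 * (l*(l^2-4*m)/8*(w 0 * z 1 + w 1 * z 0)) * p 0 * v 0
        + l*(4*m-l^2)/4*(w 0 * z 0 - w 1 * z 1) * (v 0 * p 1 + p 0 * v 1)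
        + 2 * (-(l*(l^2-4*m)/8*(w 0 * z 1 + w 1 * z 0))) * p 1 * v 1) / bcvF m p ^ 2
    - 2 * (l*(l^2-4*m)/8*(w 0 * z 1 + w 1 * z 0) * p 0 ^ 2 + l*(4*m-l^2)/4*(w 0 * z 0 - w 1 * z 1) * (p 0 * p 1)
      + -(l*(l^2-4*m)/8*(w 0 * z 1 + w 1 * z 0)) * p 1 ^ 2) * (2 * m * (p 0 * v 0 + p 1 * v 1)) / bcvF m p ^ 3 := by
  rw [aux_fd' 0 1 m 0 (-(l^2/4 * (w 0 * z 2 + w 2 * z 0))) (-(l^2/4 * (w 1 * z 2 + w 2 * z 1)))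
    0 (l*(l^2-4*m)/8*(w 0 * z 1 + w 1 * z 0)) (l*(4*m-l^2)/4*(w 0 * z 0 - w 1 * z 1))
    (-(l*(l^2-4*m)/8*(w 0 * z 1 + w 1 * z 0))) _ p v hF]
  · simp [bcvF]
  · filter_upwards with q
    rw [Gb2]; simp [bcvF]


def om (m l : ℝ) (p v : Pt 3) : ℝ := l * (p 1 * v 0 - p 0 * v 1) / (2 * bcvF m p) + v 2

def ip (m l : ℝ) (p v w : Pt 3) : ℝ := (v 0 * w 0 + v 1 * w 1) / bcvF m p ^ 2 + om m l p v * om m l p w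

set_option maxHeartbeats 4000000 in
theorem curv_formula (m l : ℝ) (P : Pt 3) (hF : bcvF m P ≠ 0) (v w z : Pt 3) (k : Fin 3) :
    curvPt (bcvMet m l) P v w z k =
      (4 * m - 3 * l ^ 2 / 4) * (ip m l P w z * v k - ip m l P v z * w k)
      - (4 * m - l ^ 2) * (om m l P w * om m l P z * v k - om m l P v * om m l P z * w k
         + (ip m l P w z * om m l P v - ip m l P v z * om m l P w) * (![0, 0, 1] : Pt 3) k) := by
  have hF' : 1 + m * (P 0 ^ 2 + P 1 ^ 2) ≠ 0 := hF
  rw [bcv_curv m l P hF]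
  fin_cases k <;> simp only [Fin.zero_eta, Fin.mk_one, Fin.reduceFinMk]
  · rw [fdGb0 m l P _ _ _ hF, fdGb0 m l P _ _ _ hF]
    simp [Gb0, Gb1, Gb2, ip, om]
    field_simp
    simp only [bcvF]
    ring
  · rw [fdGb1 m l P _ _ _ hF, fdGb1 m l P _ _ _ hF]
    simp [Gb0, Gb1, Gb2, ip, om]
    field_simp
    simp only [bcvF]
    ring
  · rw [fdGb2 m l P _ _ _ hF, fdGb2 m l P _ _ _ hF]
    simp [Gb0, Gb1, Gb2, ip, om]
    field_simp
    simp only [bcvF]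
    ring

theorem curv_tr (m l : ℝ) (P : Pt 3) (hF : bcvF m P ≠ 0) (a b K c d : ℝ)
    (hab : a ^ 2 + b ^ 2 = bcvF m P ^ 2) (hc : c = -(l * (P 0 * b - P 1 * a)) / (2 * bcvF m P))
    (hd : d = l * (P 0 * a + P 1 * b) / (2 * bcvF m P)) (V : Pt 3) (hV : V = ![-(K * b), K * a, K * d]) (k : Fin 3) :
    curvPt (bcvMet m l) P ![a, b, 0] V ![a, b, 0] k
      - c * curvPt (bcvMet m l) P ![a, b, 0] V ![0, 0, 1] k
      - c * curvPt (bcvMet m l) P ![0, 0, 1] V ![a, b, 0] k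
      + (1 + c ^ 2) * curvPt (bcvMet m l) P ![0, 0, 1] V ![0, 0, 1] k
      = -((4 * m - l ^ 2 / 2) * V k) := by
  have o1 : om m l P ![a, b, 0] = c := by
    subst hc; simp [om]; ring
  have o2 : om m l P ![0, 0, 1] = 1 := by simp [om]
  have o3 : om m l P V = 0 := by
    subst hV hd; simp [om]; field_simp; ring
  have i1 : ip m l P ![a, b, 0] ![a, b, 0] = 1 + c ^ 2 := by
    simp only [ip, o1]; simp
    rw [← pow_two, ← pow_two, hab, div_self (pow_ne_zero 2 hF)]; ring
  have i2 : ip m l P ![a, b, 0] ![0, 0, 1] = c := by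
    simp only [ip, o1, o2]; simp
  have i3 : ip m l P ![0, 0, 1] ![a, b, 0] = c := by
    simp only [ip, o1, o2]; simp
  have i4 : ip m l P ![0, 0, 1] ![0, 0, 1] = 1 := by
    simp only [ip, o2]; simp
  have i5 : ip m l P V ![a, b, 0] = 0 := by
    simp only [ip, o3]; subst hV; simp; left; ring
  have i6 : ip m l P V ![0, 0, 1] = 0 := by
    simp only [ip, o3]; simp
  simp only [curv_formula m l P hF, o1, o2, o3, i1, i2, i3, i4, i5, i6]
  ring

theorem gip_bcv (m l : ℝ) (p v w : Pt 3) : gip (bcvMet m l) p v w = ip m l p v w := by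
  simp [gip, bcvMet, bcvω, ip, om, Fin.sum_univ_three]
  ring

theorem fd_comp_s2 (f : ℝ → ℝ) (u v : Pt 2) (d : ℝ) (hf : HasDerivAt f d (u 0)) :
    fderiv ℝ (fun q : Pt 2 => f (q 0)) u v = d * v 0 := by
  have h1 : HasFDerivAt (fun q : Pt 2 => q 0) (ContinuousLinearMap.proj (R := ℝ) (φ := fun _ : Fin 2 => ℝ) 0) u :=
    hasFDerivAt_apply 0 u
  have := (hf.comp_hasFDerivAt u h1).fderiv
  simp only [Function.comp_def] at this
  rw [this]; simp

structure Dat (m l : ℝ) (x y p q κ c : ℝ → ℝ) : Prop where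
  hF : ∀ s, 1 + m * (x s ^ 2 + y s ^ 2) ≠ 0
  hx : ∀ s, HasDerivAt x (p s) s
  hy : ∀ s, HasDerivAt y (q s) s
  hp : ∀ s, HasDerivAt p (2 * m / (1 + m * (x s ^ 2 + y s ^ 2)) *
    ((x s * p s + y s * q s) * p s - (x s * q s - y s * p s) * q s) - κ s * q s) s
  hq : ∀ s, HasDerivAt q (2 * m / (1 + m * (x s ^ 2 + y s ^ 2)) *
    ((x s * p s + y s * q s) * q s + (x s * q s - y s * p s) * p s) + κ s * p s) s
  hpq : ∀ s, p s ^ 2 + q s ^ 2 = (1 + m * (x s ^ 2 + y s ^ 2)) ^ 2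
  hc : ∀ s, c s = -(l * (x s * q s - y s * p s)) / (2 * (1 + m * (x s ^ 2 + y s ^ 2)))
  hk : Differentiable ℝ κ
  hk2 : Differentiable ℝ (deriv κ)
  hcd : Differentiable ℝ c

def ee (m l : ℝ) (x y p q : ℝ → ℝ) (s : ℝ) : ℝ :=
  l * (x s * p s + y s * q s) / (2 * (1 + m * (x s ^ 2 + y s ^ 2)))

def fr (m l : ℝ) (x y p q c : ℝ → ℝ) (a b d : ℝ → ℝ) : Pt 2 → Pt 3 := fun u =>
  ![a (u 0) * p (u 0) - b (u 0) * q (u 0), a (u 0) * q (u 0) + b (u 0) * p (u 0),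
    -(a (u 0) * c (u 0)) + b (u 0) * ee m l x y p q (u 0) + d (u 0)]

def ph (x y : ℝ → ℝ) : Pt 2 → Pt 3 := fun u => ![x (u 0), y (u 0), u 1]

section
variable {m l : ℝ} {x y p q κ c : ℝ → ℝ}

theorem dmap0 (D : Dat m l x y p q κ c) (u : Pt 2) : dmap (ph x y) u 0 = ![p (u 0), q (u 0), 0] := by
  ext k
  fin_cases k
  · simp only [dmap, ph]; simp; rw [fd_comp_s2 x u _ _ (D.hx _)]; simp
  · simp only [dmap, ph]; simp; rw [fd_comp_s2 y u _ _ (D.hy _)]; simp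
  · simp only [dmap, ph]; simp
    rw [(hasFDerivAt_apply (𝕜 := ℝ) (1 : Fin 2) u).fderiv]; simp

theorem dmap1 (D : Dat m l x y p q κ c) (u : Pt 2) : dmap (ph x y) u 1 = ![0, 0, 1] := by
  ext k
  fin_cases k
  · simp only [dmap, ph]; simp; rw [fd_comp_s2 x u _ _ (D.hx _)]; simp
  · simp only [dmap, ph]; simp; rw [fd_comp_s2 y u _ _ (D.hy _)]; simp
  · simp only [dmap, ph]; simp
    rw [(hasFDerivAt_apply (𝕜 := ℝ) (1 : Fin 2) u).fderiv]; simp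

theorem hFph (D : Dat m l x y p q κ c) (u : Pt 2) : bcvF m (ph x y u) ≠ 0 := by
  simpa [bcvF, ph] using D.hF (u 0)

theorem covAlong_Gb (D : Dat m l x y p q κ c) (V : Pt 2 → Pt 3) (a : Fin 2) (u : Pt 2) (k : Fin 3) :
    covAlong (bcvMet m l) (ph x y) V a u k = fderiv ℝ (fun q => V q k) u (Pi.single a 1)
      + Gb m l (ph x y u) (dmap (ph x y) u a) (V u) k := by
  simp only [covAlong, Gb, bcv_christoffel m l _ (hFph D u)]

theorem hasD_c (D : Dat m l x y p q κ c) (s : ℝ) : HasDerivAt c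
    (-(l / 2) * ((4 * m * (x s * p s + y s * q s) * (x s * q s - y s * p s) / (1 + m * (x s ^ 2 + y s ^ 2)) + κ s * (x s * p s + y s * q s))
      / (1 + m * (x s ^ 2 + y s ^ 2)) - (x s * q s - y s * p s) * (2 * m * (x s * p s + y s * q s)) / (1 + m * (x s ^ 2 + y s ^ 2)) ^ 2)) s := by
  have hc : c = fun s => -(l * (x s * q s - y s * p s)) / (2 * (1 + m * (x s ^ 2 + y s ^ 2))) := funext D.hc
  rw [hc]
  have hF := D.hF s
  have h := ((((D.hx s).mul (D.hq s)).sub ((D.hy s).mul (D.hp s))).const_mul l).neg.div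
    ((((((D.hx s).pow 2).add ((D.hy s).pow 2)).const_mul m).const_add 1).const_mul 2)
    (by simpa using hF)
  refine h.congr_deriv ?_
  simp
  field_simp
  ring

theorem hasD_e (D : Dat m l x y p q κ c) (s : ℝ) : HasDerivAt (ee m l x y p q)
    ((l / 2) * ((p s ^ 2 + q s ^ 2 + 2 * m / (1 + m * (x s ^ 2 + y s ^ 2)) * ((x s * p s + y s * q s)^2 - (x s * q s - y s * p s)^2) - κ s * (x s * q s - y s * p s))
      / (1 + m * (x s ^ 2 + y s ^ 2)) - (x s * p s + y s * q s) * (2 * m * (x s * p s + y s * q s)) / (1 + m * (x s ^ 2 + y s ^ 2)) ^ 2)) s := by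
  have hF := D.hF s
  have h := ((((D.hx s).mul (D.hp s)).add ((D.hy s).mul (D.hq s))).const_mul l).div
    ((((((D.hx s).pow 2).add ((D.hy s).pow 2)).const_mul m).const_add 1).const_mul 2)
    (by simpa using hF)
  refine h.congr_deriv ?_
  simp
  field_simp
  ring

theorem cov0 (D : Dat m l x y p q κ c) (a b d : ℝ → ℝ) (ha : Differentiable ℝ a)
    (hb : Differentiable ℝ b) (hd : Differentiable ℝ d) :
    covAlong (bcvMet m l) (ph x y) (fr m l x y p q c a b d) 0 =
      fr m l x y p q c (fun s => deriv a s - κ s * b s + c s * (l / 2) * b s)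
        (fun s => deriv b s + κ s * a s - c s * (l / 2) * a s - l / 2 * d s)
        (fun s => deriv d s + l / 2 * b s) := by
  funext u
  ext k
  rw [covAlong_Gb D, dmap0 D]
  have hF := D.hF (u 0)
  have hpq := D.hpq (u 0)
  have h1 : (p (u 0) ^ 2 + q (u 0) ^ 2) / (1 + m * (x (u 0) ^ 2 + y (u 0) ^ 2)) ^ 2 = 1 := by
    rw [hpq, div_self (pow_ne_zero 2 hF)]
  have ha' := (ha (u 0)).hasDerivAt
  have hb' := (hb (u 0)).hasDerivAt
  have hd' := (hd (u 0)).hasDerivAt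
  have hc := D.hc (u 0)
  fin_cases k <;> simp only [Fin.zero_eta, Fin.mk_one, Fin.reduceFinMk]
  · have := fd_comp_s2 _ u (Pi.single 0 1) _ ((ha'.mul (D.hp (u 0))).sub (hb'.mul (D.hq (u 0))))
    simp only [Pi.sub_apply, Pi.mul_apply] at this
    simp only [fr, Matrix.cons_val_zero, this]
    simp [Gb0, ph, bcvF, ee, hc]
    field_simp
    ring
  · have := fd_comp_s2 _ u (Pi.single 0 1) _ ((ha'.mul (D.hq (u 0))).add (hb'.mul (D.hp (u 0))))
    simp only [Pi.add_apply, Pi.mul_apply] at this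
    simp only [fr, Matrix.cons_val_one, Matrix.cons_val_zero, this]
    simp [Gb1, ph, bcvF, ee, hc]
    field_simp
    ring
  · have := fd_comp_s2 _ u (Pi.single 0 1) _ (((ha'.mul (hasD_c D (u 0))).neg.add (hb'.mul (hasD_e D (u 0)))).add hd')
    simp only [Pi.add_apply, Pi.mul_apply, Pi.neg_apply] at this
    simp only [fr, Matrix.cons_val, this]
    simp [Gb2, ph, bcvF, ee, hc]
    linear_combination (norm := (field_simp; ring)) (b (u 0) * l / 2) * h1

theorem cov1 (D : Dat m l x y p q κ c) (a b d : ℝ → ℝ) (ha : Differentiable ℝ a)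
    (hb : Differentiable ℝ b) (hd : Differentiable ℝ d) :
    covAlong (bcvMet m l) (ph x y) (fr m l x y p q c a b d) 1 =
      fr m l x y p q c (fun s => l / 2 * b s) (fun s => -(l / 2 * a s)) (fun _ => 0) := by
  funext u
  ext k
  rw [covAlong_Gb D, dmap1 D]
  have hF := D.hF (u 0)
  have ha' := (ha (u 0)).hasDerivAt
  have hb' := (hb (u 0)).hasDerivAt
  have hd' := (hd (u 0)).hasDerivAt
  have hc := D.hc (u 0)
  fin_cases k <;> simp only [Fin.zero_eta, Fin.mk_one, Fin.reduceFinMk]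
  · have := fd_comp_s2 _ u (Pi.single 1 1) _ ((ha'.mul (D.hp (u 0))).sub (hb'.mul (D.hq (u 0))))
    simp only [Pi.sub_apply, Pi.mul_apply] at this
    simp only [fr, Matrix.cons_val_zero, this]
    simp [Gb0, ph, bcvF, ee, hc]
    try ring
  · have := fd_comp_s2 _ u (Pi.single 1 1) _ ((ha'.mul (D.hq (u 0))).add (hb'.mul (D.hp (u 0))))
    simp only [Pi.add_apply, Pi.mul_apply] at this
    simp only [fr, Matrix.cons_val_one, Matrix.cons_val_zero, this]
    simp [Gb1, ph, bcvF, ee, hc]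
    try ring
  · have := fd_comp_s2 _ u (Pi.single 1 1) _ (((ha'.mul (hasD_c D (u 0))).neg.add (hb'.mul (hasD_e D (u 0)))).add hd')
    simp only [Pi.add_apply, Pi.mul_apply, Pi.neg_apply] at this
    simp only [fr, Matrix.cons_val, this]
    simp [Gb2, ph, bcvF, ee, hc]
    field_simp
    try ring

theorem fff_eq_s2 (D : Dat m l x y p q κ c) (u : Pt 2) : fff (bcvMet m l) (ph x y) u =
    !![1 + c (u 0) ^ 2, c (u 0); c (u 0), 1] := by
  have hF := D.hF (u 0)
  have hpq := D.hpq (u 0)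
  have h1 : (p (u 0) ^ 2 + q (u 0) ^ 2) / (1 + m * (x (u 0) ^ 2 + y (u 0) ^ 2)) ^ 2 = 1 := by
    rw [hpq, div_self (pow_ne_zero 2 hF)]
  have o1 : om m l (ph x y u) ![p (u 0), q (u 0), 0] = c (u 0) := by
    rw [D.hc]; simp [om, ph, bcvF]; ring
  have o2 : om m l (ph x y u) ![0, 0, 1] = 1 := by simp [om]
  ext a b
  fin_cases a <;> fin_cases b <;> simp [fff, dmap0 D, dmap1 D, gip_bcv, ip, o1, o2]
  simp only [ph, bcvF]; simp
  linear_combination h1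

theorem fff_inv (D : Dat m l x y p q κ c) (u : Pt 2) : (fff (bcvMet m l) (ph x y) u)⁻¹ =
    !![1, -c (u 0); -c (u 0), 1 + c (u 0) ^ 2] := by
  rw [fff_eq_s2 D]
  apply Matrix.inv_eq_right_inv
  ext a b
  fin_cases a <;> fin_cases b <;> simp [Matrix.mul_apply] <;> ring

theorem fff_chr (D : Dat m l x y p q κ c) (u : Pt 2) (k i j : Fin 2) :
    christoffel (fff (bcvMet m l) (ph x y)) u k i j =
      if k = 1 ∧ i = 0 ∧ j = 0 then deriv c (u 0) else 0 := by
  have hc := (D.hcd (u 0)).hasDerivAt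
  have e1 : ∀ v, fderiv ℝ (fun q : Pt 2 => c (q 0)) u v = deriv c (u 0) * v 0 :=
    fun v => fd_comp_s2 c u v _ hc
  have e2 : ∀ v, fderiv ℝ (fun q : Pt 2 => c (q 0) ^ 2) u v = (2 * c (u 0) * deriv c (u 0)) * v 0 := by
    intro v
    have := fd_comp_s2 _ u v _ (hc.pow 2)
    simp only [Pi.pow_apply] at this
    rw [this]; simp
  unfold christoffel
  simp only [fff_inv D]
  simp only [fff_eq_s2 D, Fin.sum_univ_two]
  fin_cases k <;> fin_cases i <;> fin_cases j <;> simp [e1, e2] <;> (try ring)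

end

section
variable {m l : ℝ} {x y p q κ c : ℝ → ℝ}

theorem tension_eq_s2 (D : Dat m l x y p q κ c) :
    tension (bcvMet m l) (ph x y) = fr m l x y p q c (fun _ => 0) κ (fun _ => 0) := by
  have d0 : (fun u => dmap (ph x y) u 0) = fr m l x y p q c (fun _ => 1) (fun _ => 0) c := by
    funext u; rw [dmap0 D]; simp [fr]
  have d1 : (fun u => dmap (ph x y) u 1) = fr m l x y p q c (fun _ => 0) (fun _ => 0) (fun _ => 1) := by
    funext u; rw [dmap1 D]; simp [fr]
  funext u
  ext k
  have h : tension (bcvMet m l) (ph x y) u k = ∑ a, ∑ b, (fff (bcvMet m l) (ph x y) u)⁻¹ a b *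
      (covAlong (bcvMet m l) (ph x y) (fun u => dmap (ph x y) u b) a u k
        - ∑ c, christoffel (fff (bcvMet m l) (ph x y)) u c a b * dmap (ph x y) u c k) := by
    simp only [tension, covAlong]
    refine Finset.sum_congr rfl fun a _ => Finset.sum_congr rfl fun b _ => ?_
    ring
  rw [h]
  have hc1 : Differentiable ℝ (fun _ : ℝ => (1:ℝ)) := differentiable_const _
  have hc0 : Differentiable ℝ (fun _ : ℝ => (0:ℝ)) := differentiable_const _
  simp only [Fin.sum_univ_two, fff_inv D, fff_chr D, d0, d1, cov0 D _ _ _ hc1 hc0 D.hcd,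
    cov0 D _ _ _ hc0 hc0 hc1, cov1 D _ _ _ hc1 hc0 D.hcd, cov1 D _ _ _ hc0 hc0 hc1]
  simp only [dmap1 D]
  fin_cases k <;> simp [fr] <;> ring

theorem bitension_eq_s2 (D : Dat m l x y p q κ c) :
    bitension (bcvMet m l) (ph x y) = fr m l x y p q c (fun s => -3 * κ s * deriv κ s)
      (fun s => deriv (deriv κ) s - κ s ^ 3 - l ^ 2 * κ s + 4 * m * κ s) (fun s => l * deriv κ s) := by
  funext u
  ext k
  have hc0 : Differentiable ℝ (fun _ : ℝ => (0:ℝ)) := differentiable_const _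
  have hk := D.hk
  have hk2 := D.hk2
  have hcd := D.hcd
  have hT : tension (bcvMet m l) (ph x y) u =
      ![-(κ (u 0) * q (u 0)), κ (u 0) * p (u 0), κ (u 0) * ee m l x y p q (u 0)] := by
    rw [tension_eq_s2 D]; simp [fr]
  have hR := curv_tr m l (ph x y u) (hFph D u) (p (u 0)) (q (u 0)) (κ (u 0)) (c (u 0))
    (ee m l x y p q (u 0)) (by rw [D.hpq]; simp [bcvF, ph]) (by rw [D.hc]; simp [bcvF, ph])
    (by simp [bcvF, ph, ee]) _ hT k
  have hR2 : ∑ a, ∑ b, (fff (bcvMet m l) (ph x y) u)⁻¹ a b *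
        curvPt (bcvMet m l) (ph x y u) (dmap (ph x y) u a) (tension (bcvMet m l) (ph x y) u) (dmap (ph x y) u b) k
      = -((4 * m - l ^ 2 / 2) * tension (bcvMet m l) (ph x y) u k) := by
    rw [← hR]
    simp only [Fin.sum_univ_two, fff_inv D, dmap0 D, dmap1 D]
    simp
    ring
  have e0 := cov0 D _ _ _ hc0 hk hc0
  have e1 := cov1 D _ _ _ hc0 hk hc0
  have e00 := cov0 D (fun s => deriv (fun _ => (0:ℝ)) s - κ s * κ s + c s * (l / 2) * κ s)
    (fun s => deriv κ s + κ s * 0 - c s * (l / 2) * 0 - l / 2 * 0)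
    (fun s => deriv (fun _ => (0:ℝ)) s + l / 2 * κ s) (by simp; fun_prop) (by simp; fun_prop) (by simp; fun_prop)
  have e10 := cov1 D (fun s => deriv (fun _ => (0:ℝ)) s - κ s * κ s + c s * (l / 2) * κ s)
    (fun s => deriv κ s + κ s * 0 - c s * (l / 2) * 0 - l / 2 * 0)
    (fun s => deriv (fun _ => (0:ℝ)) s + l / 2 * κ s) (by simp; fun_prop) (by simp; fun_prop) (by simp; fun_prop)
  have e01 := cov0 D (fun s => l / 2 * κ s) (fun s => -(l / 2 * 0)) (fun _ => 0)
    (by fun_prop) (by fun_prop) (by fun_prop)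
  have e11 := cov1 D (fun s => l / 2 * κ s) (fun s => -(l / 2 * 0)) (fun _ => 0)
    (by fun_prop) (by fun_prop) (by fun_prop)
  have f1 : deriv (fun s => -(κ s * κ s) + c s * (l / 2) * κ s) (u 0) = -(2 * κ (u 0) * deriv κ (u 0))
      + deriv c (u 0) * (l / 2) * κ (u 0) + c (u 0) * (l / 2) * deriv κ (u 0) := by
    have a1 := (hk (u 0)).hasDerivAt
    have a2 := (hcd (u 0)).hasDerivAt
    refine HasDerivAt.deriv (((a1.mul a1).neg.add ((a2.mul_const (l/2)).mul a1)).congr_deriv ?_)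
    ring
  have f2 : deriv (fun s => l / 2 * κ s) (u 0) = l / 2 * deriv κ (u 0) :=
    deriv_const_mul _ (hk (u 0))
  unfold bitension
  rw [hR2, tension_eq_s2 D]
  simp only [Fin.sum_univ_two, fff_inv D, fff_chr D]
  rw [e0, e1, e00, e10, e01, e11]
  fin_cases k <;> simp [fr, f1, f2] <;> ring

end

theorem base_chr (m : ℝ) (P : Pt 2) (hF : 1 + m * (P 0 ^ 2 + P 1 ^ 2) ≠ 0) (k i j : Fin 2) :
    christoffel (bcvBase m) P k i j =
     (![!![-(2*m*P 0/(1 + m * (P 0 ^ 2 + P 1 ^ 2))), -(2*m*P 1/(1 + m * (P 0 ^ 2 + P 1 ^ 2)));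
           -(2*m*P 1/(1 + m * (P 0 ^ 2 + P 1 ^ 2))), 2*m*P 0/(1 + m * (P 0 ^ 2 + P 1 ^ 2))],
        !![2*m*P 1/(1 + m * (P 0 ^ 2 + P 1 ^ 2)), -(2*m*P 0/(1 + m * (P 0 ^ 2 + P 1 ^ 2)));
           -(2*m*P 0/(1 + m * (P 0 ^ 2 + P 1 ^ 2))), -(2*m*P 1/(1 + m * (P 0 ^ 2 + P 1 ^ 2)))]]
      : Fin 2 → Matrix (Fin 2) (Fin 2) ℝ) k i j := by
  have hinv : (bcvBase m P)⁻¹ = !![(1 + m * (P 0 ^ 2 + P 1 ^ 2)) ^ 2, 0; 0, (1 + m * (P 0 ^ 2 + P 1 ^ 2)) ^ 2] := by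
    apply Matrix.inv_eq_right_inv
    ext i j
    fin_cases i <;> fin_cases j <;> simp [bcvBase, Matrix.mul_apply] <;> field_simp
  have hfd : ∀ i j v, fderiv ℝ (fun q => bcvBase m q i j) P v =
      if i = j then -2 * (2 * m * (P 0 * v 0 + P 1 * v 1)) / (1 + m * (P 0 ^ 2 + P 1 ^ 2)) ^ 3 else 0 := by
    intro i j v
    split_ifs with h
    · rw [aux_fd' 0 1 m 0 0 0 1 0 0 0 _ P v hF]
      · simp; ring
      · filter_upwards with q
        simp [bcvBase, h]
    · have : (fun q => bcvBase m q i j) = fun _ => 0 := by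
        funext q; simp [bcvBase, h]
      rw [this]; simp
  unfold christoffel
  simp only [hinv, hfd, Fin.sum_univ_two]
  fin_cases k <;> fin_cases i <;> fin_cases j <;> simp <;> field_simp

theorem dat_of (m l : ℝ) (α : ℝ → Pt 2) (hα : ContDiff ℝ (⊤ : ℕ∞) α)
    (harc : ∀ s, gip (bcvBase m) (α s) (deriv α s) (deriv α s) = 1)
    (hdom : ∀ s, 0 < 1 + m * (α s 0 ^ 2 + α s 1 ^ 2)) :
    ∃ p q c, Dat m l (fun s => α s 0) (fun s => α s 1) p q (geodCurv m α) c := by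
  set x := fun s => α s 0 with hxdef
  set y := fun s => α s 1 with hydef
  have hx : ContDiff ℝ (⊤ : ℕ∞) x := contDiff_pi.1 hα 0
  have hy : ContDiff ℝ (⊤ : ℕ∞) y := contDiff_pi.1 hα 1
  have hx1 : ContDiff ℝ (⊤ : ℕ∞) (deriv x) := (contDiff_infty_iff_deriv.1 hx).2
  have hy1 : ContDiff ℝ (⊤ : ℕ∞) (deriv y) := (contDiff_infty_iff_deriv.1 hy).2
  have hx2 : ContDiff ℝ (⊤ : ℕ∞) (deriv (deriv x)) := (contDiff_infty_iff_deriv.1 hx1).2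
  have hy2 : ContDiff ℝ (⊤ : ℕ∞) (deriv (deriv y)) := (contDiff_infty_iff_deriv.1 hy1).2
  have hne : (⊤ : ℕ∞) ≠ 0 := by simp
  have hdx : ∀ s, HasDerivAt x (deriv x s) s := fun s => (hx.differentiable (by simp) s).hasDerivAt
  have hdy : ∀ s, HasDerivAt y (deriv y s) s := fun s => (hy.differentiable (by simp) s).hasDerivAt
  have hdx1 : ∀ s, HasDerivAt (deriv x) (deriv (deriv x) s) s :=
    fun s => (hx1.differentiable (by simp) s).hasDerivAt
  have hdy1 : ∀ s, HasDerivAt (deriv y) (deriv (deriv y) s) s :=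
    fun s => (hy1.differentiable (by simp) s).hasDerivAt
  have hd : ∀ s, deriv α s = ![deriv x s, deriv y s] := by
    intro s
    apply HasDerivAt.deriv
    rw [hasDerivAt_pi]
    intro i
    fin_cases i
    · exact hdx s
    · exact hdy s
  have hF : ∀ s, 1 + m * (x s ^ 2 + y s ^ 2) ≠ 0 := fun s => (hdom s).ne'
  have hpq : ∀ s, deriv x s ^ 2 + deriv y s ^ 2 = (1 + m * (x s ^ 2 + y s ^ 2)) ^ 2 := by
    intro s
    have h := harc s
    have hFs := hF s
    rw [hd] at h
    simp [gip, bcvBase, Fin.sum_univ_two] at h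
    change ((1 + m * (x s ^ 2 + y s ^ 2)) ^ 2)⁻¹ * _ * _ + ((1 + m * (x s ^ 2 + y s ^ 2)) ^ 2)⁻¹ * _ * _ = 1 at h
    field_simp at h
    linarith
  have hpq' : ∀ s, deriv x s * deriv (deriv x) s + deriv y s * deriv (deriv y) s
      = (1 + m * (x s ^ 2 + y s ^ 2)) * (2 * m * (x s * deriv x s + y s * deriv y s)) := by
    intro s
    have h1 := ((hdx1 s).pow 2).add ((hdy1 s).pow 2)
    have h2 := ((((((hdx s).pow 2).add ((hdy s).pow 2)).const_mul m).const_add 1).pow 2)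
    have h3 : deriv x ^ 2 + deriv y ^ 2 = (fun s => 1 + m * (x ^ 2 + y ^ 2) s) ^ 2 := by
      funext s; simpa using hpq s
    rw [h3] at h1
    have := h1.unique h2
    simp at this
    linarith
  have hκ : ∀ s, geodCurv m α s = (deriv x s * deriv (deriv y) s - deriv y s * deriv (deriv x) s)
      / (1 + m * (x s ^ 2 + y s ^ 2)) ^ 2
      - 2 * m * (x s * deriv y s - y s * deriv x s) / (1 + m * (x s ^ 2 + y s ^ 2)) := by
    intro s
    have hFs := hF s
    have hFa : 1 + m * (α s 0 ^ 2 + α s 1 ^ 2) ≠ 0 := hFs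
    unfold geodCurv
    simp only [hd, base_chr m (α s) hFa]
    simp [gip, bcvBase, Fin.sum_univ_two]
    rw [show α s 0 = x s from rfl, show α s 1 = y s from rfl,
      show (fun t => deriv x t) = deriv x from rfl, show (fun t => deriv y t) = deriv y from rfl]
    have e := hpq s
    linear_combination (norm := (field_simp; ring)) (-(2 * m * (x s * deriv y s - y s * deriv x s)) / (1 + m * (x s ^ 2 + y s ^ 2)) ^ 3) * e
  have hκf : geodCurv m α = fun s => (deriv x s * deriv (deriv y) s - deriv y s * deriv (deriv x) s)
      / (1 + m * (x s ^ 2 + y s ^ 2)) ^ 2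
      - 2 * m * (x s * deriv y s - y s * deriv x s) / (1 + m * (x s ^ 2 + y s ^ 2)) := funext hκ
  have hFc : ContDiff ℝ (⊤ : ℕ∞) (fun s => 1 + m * (x s ^ 2 + y s ^ 2)) := by fun_prop
  have hκs : ContDiff ℝ (⊤ : ℕ∞) (geodCurv m α) := by
    rw [hκf]
    refine ContDiff.sub (ContDiff.div (by fun_prop) (hFc.pow 2) fun s => pow_ne_zero 2 (hF s))
      (ContDiff.div (by fun_prop) hFc hF)
  have hκs1 : ContDiff ℝ (⊤ : ℕ∞) (deriv (geodCurv m α)) := (contDiff_infty_iff_deriv.1 hκs).2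
  refine ⟨deriv x, deriv y, fun s => -(l * (x s * deriv y s - y s * deriv x s)) / (2 * (1 + m * (x s ^ 2 + y s ^ 2))),
    hF, hdx, hdy, ?_, ?_, hpq, fun _ => rfl, hκs.differentiable (by simp), hκs1.differentiable (by simp), ?_⟩
  · intro s
    refine (hdx1 s).congr_deriv ?_
    rw [hκ]
    have hFs := hF s
    have e := hpq s
    have e' := hpq' s
    generalize deriv (deriv x) s = p2 at *
    generalize deriv (deriv y) s = q2 at *
    generalize deriv x s = p at *
    generalize deriv y s = q at *
    linear_combination (norm := (field_simp; ring)) (-p2 / (1 + m * (x s ^ 2 + y s ^ 2)) ^ 2) * e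
      + (p / (1 + m * (x s ^ 2 + y s ^ 2)) ^ 2) * e'
  · intro s
    refine (hdy1 s).congr_deriv ?_
    rw [hκ]
    have hFs := hF s
    have e := hpq s
    have e' := hpq' s
    generalize deriv (deriv x) s = p2 at *
    generalize deriv (deriv y) s = q2 at *
    generalize deriv x s = p at *
    generalize deriv y s = q at *
    linear_combination (norm := (field_simp; ring)) (-q2 / (1 + m * (x s ^ 2 + y s ^ 2)) ^ 2) * e
      + (q / (1 + m * (x s ^ 2 + y s ^ 2)) ^ 2) * e'
  · refine ContDiff.differentiable (n := (⊤ : ℕ∞)) ?_ (by simp)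
    refine ContDiff.div (by fun_prop) (by fun_prop) fun s => mul_ne_zero two_ne_zero (hF s)

theorem fr_zero {m l : ℝ} {x y p q κ c : ℝ → ℝ} (D : Dat m l x y p q κ c) (a b d : ℝ → ℝ) (u : Pt 2) :
    fr m l x y p q c a b d u = 0 ↔ a (u 0) = 0 ∧ b (u 0) = 0 ∧ d (u 0) = 0 := by
  constructor
  · intro h
    have h0 := congrFun h 0
    have h1 := congrFun h 1
    have h2 := congrFun h 2
    simp [fr] at h0 h1 h2
    have hN : p (u 0) ^ 2 + q (u 0) ^ 2 ≠ 0 := by rw [D.hpq]; exact pow_ne_zero 2 (D.hF _)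
    have ha : a (u 0) = 0 := by
      apply (mul_eq_zero.1 (?_ : a (u 0) * (p (u 0) ^ 2 + q (u 0) ^ 2) = 0)).resolve_right hN
      linear_combination p (u 0) * h0 + q (u 0) * h1
    have hb : b (u 0) = 0 := by
      apply (mul_eq_zero.1 (?_ : b (u 0) * (p (u 0) ^ 2 + q (u 0) ^ 2) = 0)).resolve_right hN
      linear_combination -q (u 0) * h0 + p (u 0) * h1
    refine ⟨ha, hb, ?_⟩
    simpa [ha, hb] using h2
  · rintro ⟨ha, hb, hd⟩
    ext k
    fin_cases k <;> simp [fr, ha, hb, hd]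

theorem core {m l : ℝ} {x y p q κ c : ℝ → ℝ} (D : Dat m l x y p q κ c) :
    IsProperBiharmonic (bcvMet m l) (ph x y) ↔
      0 < 4 * m - l ^ 2 ∧ ∃ κ₀ : ℝ, κ₀ ^ 2 = 4 * m - l ^ 2 ∧ ∀ s, κ s = κ₀ := by
  unfold IsProperBiharmonic IsBiharmonic IsMinimal
  simp only [bitension_eq_s2 D, tension_eq_s2 D, fr_zero D]
  constructor
  · rintro ⟨hb, hn⟩
    push Not at hn
    obtain ⟨u₀, hu₀⟩ := hn
    have hκ0 : κ (u₀ 0) ≠ 0 := by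
      intro h
      simp [h] at hu₀
    have hT : ∀ s, κ s * deriv κ s = 0 := by
      intro s
      have := (hb (fun _ => s)).1
      linarith
    have hN : ∀ s, deriv (deriv κ) s - κ s ^ 3 - l ^ 2 * κ s + 4 * m * κ s = 0 :=
      fun s => (hb (fun _ => s)).2.1
    have hsq : ∀ s, κ s ^ 2 = κ (u₀ 0) ^ 2 := by
      intro s
      refine is_const_of_deriv_eq_zero (f := fun s => κ s ^ 2) (D.hk.pow 2) ?_ s (u₀ 0)
      intro t
      have := ((D.hk t).hasDerivAt.pow 2).deriv
      refine Eq.trans this ?_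
      have h := hT t
      simp only [Nat.cast_ofNat]
      linear_combination 2 * h
    have hnz : ∀ s, κ s ≠ 0 := by
      intro s h
      have := hsq s
      rw [h] at this
      exact hκ0 (by simpa using this.symm)
    have hd : ∀ s, deriv κ s = 0 := fun s => (mul_eq_zero.1 (hT s)).resolve_left (hnz s)
    have hconst : ∀ s, κ s = κ (u₀ 0) := fun s => is_const_of_deriv_eq_zero D.hk hd s _
    have hdd : deriv (deriv κ) (u₀ 0) = 0 := by
      rw [show deriv κ = fun _ => 0 from funext hd]; simp
    have hk : κ (u₀ 0) ^ 2 = 4 * m - l ^ 2 := by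
      have h := hN (u₀ 0)
      rw [hdd] at h
      apply mul_left_cancel₀ hκ0
      linear_combination -h
    refine ⟨?_, κ (u₀ 0), hk, hconst⟩
    rw [← hk]; positivity
  · rintro ⟨hpos, κ₀, hk, hc⟩
    have hκ : κ = fun _ => κ₀ := funext hc
    have hd : deriv κ = fun _ => 0 := by rw [hκ]; simp
    constructor
    · intro u
      rw [hd, hκ]
      refine ⟨by simp, ?_, by simp⟩
      simp
      linear_combination -κ₀ * hk
    · intro h
      have := (h 0).2.1
      rw [hc] at this
      rw [this] at hk
      simp at hk
      linarith

/-- Theorem 2.3. Let `π : M³_{m,l} → (ℝ², h)`, `π(x,y,z) = (x,y)` be the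
BCV Riemannian submersion and let `α` be an immersed regular curve in `(ℝ², h)`
parametrised by arclength.  The Hopf cylinder `Σ = ∪_s π⁻¹(α(s))`, parametrised by
`φ(s,t) = (α(s), t)`, is proper biharmonic if and only if it is part of:
(1) `S¹(1/(2√(2m))) × ℝ` in `S²(1/(2√m)) × ℝ` — `l = 0`, `m > 0`, base curve a circle
of radius `1/√(8m)`, i.e. of constant geodesic curvature `κ₀` with `κ₀² = 4m − l²`; or
(2) a Hopf cylinder in `SU(2)` (`l ≠ 0`, `4m − l² > 0`) over a circle of radius
`1/√(8m − l²)` in the base sphere `S²(1/(2√m))`, i.e. the base curve has constant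
geodesic curvature `κ₀` with `κ₀² = 4m − l²`. -/
theorem proper_biharmonic_hopf_cylinders_in_BCV
    (m l : ℝ) (α : ℝ → Pt 2) (hα : ContDiff ℝ (⊤ : ℕ∞) α)
    (harc : ∀ s, gip (bcvBase m) (α s) (deriv α s) (deriv α s) = 1)
    (hdom : ∀ s, 0 < 1 + m * (α s 0 ^ 2 + α s 1 ^ 2))
    (φ : Pt 2 → Pt 3) (hφ : ∀ u, φ u = ![α (u 0) 0, α (u 0) 1, u 1]) :
    IsProperBiharmonic (bcvMet m l) φ ↔
      (l = 0 ∧ 0 < m ∧ ∃ κ₀ : ℝ, κ₀ ^ 2 = 4 * m - l ^ 2 ∧ ∀ s, geodCurv m α s = κ₀) ∨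
      (l ≠ 0 ∧ 0 < 4 * m - l ^ 2 ∧
        ∃ κ₀ : ℝ, κ₀ ^ 2 = 4 * m - l ^ 2 ∧ ∀ s, geodCurv m α s = κ₀) := by
  have hφ' : φ = ph (fun s => α s 0) (fun s => α s 1) := funext hφ
  obtain ⟨p, q, c, D⟩ := dat_of m l α hα harc hdom
  rw [hφ', core D]
  constructor
  · rintro ⟨h1, h2⟩
    by_cases hl : l = 0
    · refine Or.inl ⟨hl, ?_, h2⟩
      rw [hl] at h1; linarith
    · exact Or.inr ⟨hl, h1, h2⟩
  · rintro (⟨hl, hm, h2⟩ | ⟨hl, h1, h2⟩)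
    · refine ⟨?_, h2⟩
      rw [hl]; linarith
    · exact ⟨h1, h2⟩
end
end

section
/- A surface of constant mean curvature in the Sol space (ℝ³, g_Sol = e^{2z}dx² + e^{-2z}dy² + dz²) is biharmonic if and only if it is minimal. -/
/-!
Coordinate-based Riemannian geometry on charts `ℝⁿ`, enough to express mean
curvature, second fundamental forms, curvature tensors and the (bi)tension
fields of isometric immersions, as used in
"Constant mean curvature and totally umbilical biharmonic surfaces in
3-dimensional geometries".
-/

noncomputable section

open scoped BigOperators

section helpers

open Real

lemma gip_sol (p v w : Pt 3) : gip solMet p v w =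
    exp (2 * p 2) * v 0 * w 0 + exp (-(2 * p 2)) * v 1 * w 1 + v 2 * w 2 := by
  simp [gip, solMet, Fin.sum_univ_three]

lemma sol_inv (p : Pt 3) : (solMet p)⁻¹ =
    Matrix.diagonal ![exp (-(2 * p 2)), exp (2 * p 2), 1] := by
  apply Matrix.inv_eq_right_inv
  ext i j
  fin_cases i <;> fin_cases j <;>
    simp [solMet, Matrix.mul_apply, Matrix.diagonal, ← Real.exp_add]

lemma fderiv_e1 (p v : Pt 3) :
    fderiv ℝ (fun q : Pt 3 => exp (2 * q 2)) p v = 2 * exp (2 * p 2) * v 2 := by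
  have h : HasFDerivAt (fun q : Pt 3 => q 2) (ContinuousLinearMap.proj 2 : Pt 3 →L[ℝ] ℝ) p :=
    (ContinuousLinearMap.proj 2 : Pt 3 →L[ℝ] ℝ).hasFDerivAt
  rw [((h.const_mul 2).exp).fderiv]
  simp; ring

lemma fderiv_e2 (p v : Pt 3) :
    fderiv ℝ (fun q : Pt 3 => exp (-(2 * q 2))) p v = -2 * exp (-(2 * p 2)) * v 2 := by
  have h : HasFDerivAt (fun q : Pt 3 => q 2) (ContinuousLinearMap.proj 2 : Pt 3 →L[ℝ] ℝ) p :=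
    (ContinuousLinearMap.proj 2 : Pt 3 →L[ℝ] ℝ).hasFDerivAt
  rw [((h.const_mul 2).fun_neg.exp).fderiv]
  simp; ring

lemma chr_sum (p v w : Pt 3) (k : Fin 3) :
    ∑ i, ∑ j, christoffel solMet p k i j * v i * w j =
      ![v 0 * w 2 + v 2 * w 0, -(v 1 * w 2 + v 2 * w 1),
        -exp (2 * p 2) * v 0 * w 0 + exp (-(2 * p 2)) * v 1 * w 1] k := by
  have h : exp (-(2 * p 2)) * exp (2 * p 2) = 1 := by rw [← Real.exp_add]; simp
  simp only [christoffel, sol_inv]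
  fin_cases k <;>
    simp [Fin.sum_univ_three, solMet, Matrix.diagonal, fderiv_e1, fderiv_e2]
  · linear_combination (v 0 * w 2 + v 2 * w 0) * h
  · linear_combination -(v 1 * w 2 + v 2 * w 1) * h

lemma cov_sol (X Y : VF 3) (p : Pt 3) (k : Fin 3) : cov solMet X Y p k =
    fderiv ℝ (fun q => Y q k) p (X p) +
      ![X p 0 * Y p 2 + X p 2 * Y p 0, -(X p 1 * Y p 2 + X p 2 * Y p 1),
        -exp (2 * p 2) * X p 0 * Y p 0 + exp (-(2 * p 2)) * X p 1 * Y p 1] k := by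
  simp only [cov, chr_sum]

lemma cov_const_s3 (v w : Pt 3) : cov solMet (fun _ => v) (fun _ => w) = fun p =>
      ![v 0 * w 2 + v 2 * w 0, -(v 1 * w 2 + v 2 * w 1),
        -exp (2 * p 2) * v 0 * w 0 + exp (-(2 * p 2)) * v 1 * w 1] := by
  ext p k
  rw [cov_sol]; simp

lemma fderiv_e4 (p v : Pt 3) (a b c d : ℝ) :
    fderiv ℝ (fun q : Pt 3 => -(exp (2 * q 2) * a * b) + exp (-(2 * q 2)) * c * d) p v
      = -2 * exp (2 * p 2) * v 2 * a * b - 2 * exp (-(2 * p 2)) * v 2 * c * d := by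
  have h : HasFDerivAt (fun q : Pt 3 => q 2) (ContinuousLinearMap.proj 2 : Pt 3 →L[ℝ] ℝ) p :=
    (ContinuousLinearMap.proj 2 : Pt 3 →L[ℝ] ℝ).hasFDerivAt
  rw [(((((h.const_mul 2).exp).mul_const a).mul_const b).fun_neg.fun_add
    ((((h.const_mul 2).fun_neg.exp).mul_const c).mul_const d)).fderiv]
  simp; ring

lemma curv_sol (p v w z : Pt 3) : curvPt solMet p v w z =
    ![exp (-(2 * p 2)) * (v 0 * w 1 - v 1 * w 0) * z 1 - (v 0 * w 2 - v 2 * w 0) * z 2,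
      - exp (2 * p 2) * (v 0 * w 1 - v 1 * w 0) * z 0 - (v 1 * w 2 - v 2 * w 1) * z 2,
      exp (2 * p 2) * (v 0 * w 2 - v 2 * w 0) * z 0
        + exp (-(2 * p 2)) * (v 1 * w 2 - v 2 * w 1) * z 1] := by
  have hl : lieB (fun _ : Pt 3 => v) (fun _ : Pt 3 => w) = fun _ => 0 := by
    ext p k; simp [lieB]
  ext k
  simp only [curvPt, curvOp, hl, cov_const_s3, Pi.sub_apply, cov_sol]
  fin_cases k <;> simp [fderiv_e4] <;> ring

def Sm (V : Pt 2 → Pt 3) : Prop := ∀ k, ContDiff ℝ (⊤ : ℕ∞) fun u => V u k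

lemma sm_fderiv {f : Pt 2 → ℝ} (hf : ContDiff ℝ (⊤ : ℕ∞) f) (v : Pt 2) :
    ContDiff ℝ (⊤ : ℕ∞) fun u => fderiv ℝ f u v :=
  (hf.fderiv_right (m := (⊤ : ℕ∞)) (by simp)).clm_apply contDiff_const

lemma sm_dmap {φ : Pt 2 → Pt 3} (hφ : Sm φ) (a : Fin 2) : Sm fun q => dmap φ q a :=
  fun k => sm_fderiv (hφ k) _

lemma covAlong_sol (φ V : Pt 2 → Pt 3) (a : Fin 2) (u : Pt 2) (k : Fin 3) :
    covAlong solMet φ V a u k = fderiv ℝ (fun q => V q k) u (Pi.single a 1) +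
      ![dmap φ u a 0 * V u 2 + dmap φ u a 2 * V u 0, -(dmap φ u a 1 * V u 2 + dmap φ u a 2 * V u 1),
        -exp (2 * φ u 2) * dmap φ u a 0 * V u 0 + exp (-(2 * φ u 2)) * dmap φ u a 1 * V u 1] k := by
  simp only [covAlong, chr_sum]

lemma sm_cov {φ V : Pt 2 → Pt 3} (hφ : Sm φ) (hV : Sm V) (a : Fin 2) :
    Sm (covAlong solMet φ V a) := by
  intro k
  simp only [covAlong_sol]
  have hd := sm_dmap hφ a
  have h0 := hd 0
  have h1 := hd 1
  have h2 := hd 2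
  have v0 := hV 0
  have v1 := hV 1
  have v2 := hV 2
  have p2 := hφ 2
  refine (sm_fderiv (hV k) _).add ?_
  fin_cases k <;> simp <;> fun_prop

lemma compat {φ V W : Pt 2 → Pt 3} (hφ : Sm φ) (hV : Sm V) (hW : Sm W) (a : Fin 2) (u : Pt 2) :
    fderiv ℝ (fun q => gip solMet (φ q) (V q) (W q)) u (Pi.single a 1) =
      gip solMet (φ u) (covAlong solMet φ V a u) (W u)
        + gip solMet (φ u) (V u) (covAlong solMet φ W a u) := by
  have d : ∀ {V : Pt 2 → Pt 3}, Sm V → ∀ k, HasFDerivAt (fun q => V q k)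
      (fderiv ℝ (fun q => V q k) u) u := fun h k =>
    (((h k).differentiable (by simp)) u).hasFDerivAt
  have h1 := ((((d hφ 2).const_mul 2).exp).fun_mul (d hV 0)).fun_mul (d hW 0)
  have h2 := ((((d hφ 2).const_mul 2).fun_neg.exp).fun_mul (d hV 1)).fun_mul (d hW 1)
  have h3 := (d hV 2).fun_mul (d hW 2)
  simp only [gip_sol, covAlong_sol]
  rw [((h1.fun_add h2).fun_add h3).fderiv]
  simp [dmap]
  ring

lemma snd_symm {f : Pt 2 → ℝ} (hf : ContDiff ℝ (⊤ : ℕ∞) f) (u v w : Pt 2) :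
    fderiv ℝ (fun q => fderiv ℝ f q v) u w = fderiv ℝ (fun q => fderiv ℝ f q w) u v := by
  have hd : DifferentiableAt ℝ (fderiv ℝ f) u :=
    ((hf.fderiv_right (m := (⊤ : ℕ∞)) (by simp)).differentiable (by simp)) u
  have key : ∀ v w : Pt 2, fderiv ℝ (fun q => fderiv ℝ f q v) u w = fderiv ℝ (fderiv ℝ f) u w v := by
    intro v w
    rw [fderiv_clm_apply hd (differentiableAt_const v)]
    simp
  rw [key, key]
  exact (hf.contDiffAt.isSymmSndFDerivAt (by
    simp only [minSmoothness_of_isRCLikeNormedField]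
    exact WithTop.coe_le_coe.2 (le_top : (2 : ℕ∞) ≤ ⊤))) w v

lemma cov_symm {φ : Pt 2 → Pt 3} (hφ : Sm φ) (a b : Fin 2) (u : Pt 2) :
    covAlong solMet φ (fun q => dmap φ q b) a u = covAlong solMet φ (fun q => dmap φ q a) b u := by
  ext k
  simp only [covAlong_sol]
  congr 1
  · exact snd_symm (hφ k) u _ _
  · fin_cases k <;> simp <;> ring

lemma gip_comm_s3 (p v w : Pt 3) : gip solMet p v w = gip solMet p w v := by
  simp only [gip_sol]; ring

lemma gip_pos (p v : Pt 3) (hv : v ≠ 0) : 0 < gip solMet p v v := by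
  have h0 := Real.exp_pos (2 * p 2)
  have h1 := Real.exp_pos (-(2 * p 2))
  rw [gip_sol]
  by_contra hc
  apply hv
  have a0 : 0 ≤ exp (2 * p 2) * (v 0 ^ 2) := by positivity
  have a1 : 0 ≤ exp (-(2 * p 2)) * (v 1 ^ 2) := by positivity
  have a2 := sq_nonneg (v 2)
  have b0 : exp (2 * p 2) * (v 0 ^ 2) = 0 := by nlinarith
  have b1 : exp (-(2 * p 2)) * (v 1 ^ 2) = 0 := by nlinarith
  have b2 : v 2 ^ 2 = 0 := by nlinarith
  have c0 : v 0 = 0 := by simpa using b0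
  have c1 : v 1 = 0 := by simpa using b1
  have c2 : v 2 = 0 := by simpa using b2
  ext k; fin_cases k <;> simp [c0, c1, c2]

lemma ortho_zero (p : Pt 3) (e : Fin 2 → Pt 3) (n : Pt 3) (he : LinearIndependent ℝ e)
    (hnn : gip solMet p n n = 1) (hne : ∀ a, gip solMet p n (e a) = 0) (X : Pt 3)
    (h1 : ∀ a, gip solMet p X (e a) = 0) (h2 : gip solMet p X n = 0) : X = 0 := by
  let L : Pt 3 → (Pt 3 →ₗ[ℝ] ℝ) := fun Y =>
    { toFun := fun v => gip solMet p Y v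
      map_add' := fun v w => by simp only [gip_sol, Pi.add_apply]; ring
      map_smul' := fun c v => by
        simp only [gip_sol, Pi.smul_apply, smul_eq_mul, RingHom.id_apply]; ring }
  have hn : n ∉ Submodule.span ℝ (Set.range e) := by
    intro hn
    have : Submodule.span ℝ (Set.range e) ≤ LinearMap.ker (L n) := by
      rw [Submodule.span_le]
      rintro _ ⟨a, rfl⟩
      exact hne a
    have h3 : gip solMet p n n = 0 := this hn
    rw [hnn] at h3
    exact one_ne_zero h3
  have hli : LinearIndependent ℝ (Fin.cons n e : Fin 3 → Pt 3) :=
    linearIndependent_finCons.2 ⟨he, hn⟩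
  have hs := hli.span_eq_top_of_card_eq_finrank (by simp)
  have : Submodule.span ℝ (Set.range (Fin.cons n e : Fin 3 → Pt 3)) ≤ LinearMap.ker (L X) := by
    rw [Submodule.span_le]
    rintro _ ⟨a, rfl⟩
    refine Fin.cases ?_ ?_ a
    · exact h2
    · intro i; exact h1 i
  rw [hs] at this
  have h3 : gip solMet p X X = 0 := this (Submodule.mem_top (x := X))
  by_contra hX
  exact (gip_pos p X hX).ne' h3

lemma fff_posdef {φ : Pt 2 → Pt 3} (u : Pt 2) (he : LinearIndependent ℝ (dmap φ u)) :
    (fff solMet φ u).PosDef := by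
  refine Matrix.PosDef.of_dotProduct_mulVec_pos ?_ ?_
  · ext a b
    simp [fff, gip_comm_s3]
  · intro x hx
    have hX : (x 0 • dmap φ u 0 + x 1 • dmap φ u 1) ≠ 0 := by
      intro h
      apply hx
      rw [Fintype.linearIndependent_iff] at he
      have := he x (by simpa [Fin.sum_univ_two] using h)
      ext i; simp [this i]
    have := gip_pos (φ u) _ hX
    refine lt_of_lt_of_eq this ?_
    simp [dotProduct, Matrix.mulVec, Fin.sum_univ_two, fff, gip_sol]
    ring

lemma christ_first (G : Met 2) (u : Pt 2) (a b d : Fin 2) (hs : ∀ a b, G u a b = G u b a)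
    (hdet : IsUnit (G u).det) :
    ∑ c, christoffel G u c a b * G u c d = (1 / 2) *
    (fderiv ℝ (fun q => G q b d) u (Pi.single a 1)
      + fderiv ℝ (fun q => G q a d) u (Pi.single b 1)
      - fderiv ℝ (fun q => G q a b) u (Pi.single d 1)) := by
  have hm := Matrix.mul_nonsing_inv (G u) hdet
  have m : ∀ i j, ∑ c, G u i c * (G u)⁻¹ c j = if i = j then 1 else 0 := by
    intro i j
    have := congrFun (congrFun hm i) j
    rwa [Matrix.mul_apply, Matrix.one_apply] at this
  have : ∑ c, christoffel G u c a b * G u c d = (1 / 2) * ∑ l, (∑ c, G u d c * (G u)⁻¹ c l) *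
      (fderiv ℝ (fun q => G q b l) u (Pi.single a 1)
      + fderiv ℝ (fun q => G q a l) u (Pi.single b 1)
      - fderiv ℝ (fun q => G q a b) u (Pi.single l 1)) := by
    simp only [christoffel, Fin.sum_univ_two]
    rw [hs 0 d, hs 1 d]
    ring
  rw [this]
  simp [m]

lemma christ_fff {φ : Pt 2 → Pt 3} (hφ : Sm φ) (u : Pt 2) (he : LinearIndependent ℝ (dmap φ u))
    (a b d : Fin 2) :
    ∑ c, christoffel (fff solMet φ) u c a b * gip solMet (φ u) (dmap φ u c) (dmap φ u d) =
      gip solMet (φ u) (covAlong solMet φ (fun q => dmap φ q b) a u) (dmap φ u d) := by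
  have h := christ_first (fff solMet φ) u a b d (fun a b => gip_comm_s3 _ _ _)
    (fff_posdef u he).det_pos.ne'.isUnit
  have c : ∀ i j k, fderiv ℝ (fun q => fff solMet φ q i j) u (Pi.single k 1) = _ := fun i j k =>
    compat hφ (sm_dmap hφ i) (sm_dmap hφ j) k u
  rw [c, c, c] at h
  refine h.trans ?_
  rw [cov_symm hφ d a, cov_symm hφ d b, cov_symm hφ b a,
    gip_comm_s3 _ (dmap φ u b), gip_comm_s3 _ (dmap φ u a)]
  ring

lemma tension_eq_s3 (φ : Pt 2 → Pt 3) (u : Pt 2) (k : Fin 3) : tension solMet φ u k =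
    ∑ a, ∑ b, (fff solMet φ u)⁻¹ a b * (covAlong solMet φ (fun q => dmap φ q b) a u k
      - ∑ c, christoffel (fff solMet φ) u c a b * dmap φ u c k) := by
  simp only [tension, covAlong]
  refine Finset.sum_congr rfl fun a _ => Finset.sum_congr rfl fun b _ => ?_
  ring

lemma gip_tension (φ : Pt 2 → Pt 3) (u : Pt 2) (w : Pt 3) :
    gip solMet (φ u) (tension solMet φ u) w =
    ∑ a, ∑ b, (fff solMet φ u)⁻¹ a b *
      (gip solMet (φ u) (covAlong solMet φ (fun q => dmap φ q b) a u) w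
      - ∑ c, christoffel (fff solMet φ) u c a b * gip solMet (φ u) (dmap φ u c) w) := by
  simp only [gip_sol, tension_eq_s3, Fin.sum_univ_two]
  ring

lemma tension_normal {φ ξ : Pt 2 → Pt 3} (hφ : IsImmersion φ) (hξ : IsUnitNormal solMet φ ξ)
    (u : Pt 2) : tension solMet φ u = (2 * meanCurv solMet φ ξ u) • ξ u := by
  rw [← sub_eq_zero]
  apply ortho_zero (φ u) (dmap φ u) (ξ u) (hφ.2 u) (hξ.2.1 u) (hξ.2.2 u)
  · intro d
    have h := gip_tension φ u (dmap φ u d)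
    simp only [christ_fff hφ.1 u (hφ.2 u)] at h
    have h2 := hξ.2.2 u d
    simp only [sub_self, mul_zero, Finset.sum_const_zero] at h
    simp only [gip_sol, Pi.sub_apply, Pi.smul_apply, smul_eq_mul] at h h2 ⊢
    linear_combination h - (2 * meanCurv solMet φ ξ u) * h2
  · have h := gip_tension φ u (ξ u)
    have h0 : ∀ c, gip solMet (φ u) (dmap φ u c) (ξ u) = 0 := fun c => by
      rw [gip_comm_s3]; exact hξ.2.2 u c
    have h1 : 2 * meanCurv solMet φ ξ u = ∑ a, ∑ b, (fff solMet φ u)⁻¹ a b *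
      (gip solMet (φ u) (covAlong solMet φ (fun q => dmap φ q b) a u) (ξ u)) := by
      have e : ∀ a b, sff solMet φ ξ u a b =
        gip solMet (φ u) (covAlong solMet φ (fun q => dmap φ q b) a u) (ξ u) := fun a b => rfl
      simp only [meanCurv, shapeOp, e, Fin.sum_univ_two, cov_symm hφ.1 1 0]
      push_cast
      ring
    simp only [h0, mul_zero, Finset.sum_const_zero, sub_zero] at h
    rw [← h1] at h
    have h2 := hξ.2.1 u
    simp only [gip_sol, Pi.sub_apply, Pi.smul_apply, smul_eq_mul] at h h2 ⊢
    linear_combination h - (2 * meanCurv solMet φ ξ u) * h2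

lemma proj_formula {φ ξ : Pt 2 → Pt 3} (hφ : IsImmersion φ) (hξ : IsUnitNormal solMet φ ξ)
    (u : Pt 2) (X : Pt 3) (k : Fin 3) : X k =
      ∑ a, ∑ b, (fff solMet φ u)⁻¹ a b * gip solMet (φ u) X (dmap φ u a) * dmap φ u b k
        + gip solMet (φ u) X (ξ u) * ξ u k := by
  have hp := fff_posdef u (hφ.2 u)
  have hm := Matrix.nonsing_inv_mul (fff solMet φ u) hp.det_pos.ne'.isUnit
  have m : ∀ i j, ∑ c, (fff solMet φ u)⁻¹ i c * gip solMet (φ u) (dmap φ u c) (dmap φ u j)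
      = if i = j then 1 else 0 := by
    intro i j
    have := congrFun (congrFun hm i) j
    rw [Matrix.mul_apply, Matrix.one_apply] at this
    exact this
  have key := ortho_zero (φ u) (dmap φ u) (ξ u) (hφ.2 u) (hξ.2.1 u) (hξ.2.2 u)
    (fun k => X k - (∑ a, ∑ b, (fff solMet φ u)⁻¹ a b * gip solMet (φ u) X (dmap φ u a) *
      dmap φ u b k + gip solMet (φ u) X (ξ u) * ξ u k)) ?_ ?_
  · have := congrFun key k
    simp only [Pi.zero_apply] at this
    linarith
  · intro d
    have h2 := hξ.2.2 u d
    have : ∀ x : Fin 2 → ℝ, ∀ y : ℝ, gip solMet (φ u) (fun k => X k -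
        (∑ a, ∑ b, (fff solMet φ u)⁻¹ a b * x a * dmap φ u b k + y * ξ u k)) (dmap φ u d) =
        gip solMet (φ u) X (dmap φ u d) - (∑ a, x a * ∑ b, (fff solMet φ u)⁻¹ a b *
          gip solMet (φ u) (dmap φ u b) (dmap φ u d)) - y * gip solMet (φ u) (ξ u) (dmap φ u d) := by
      intro x y
      simp only [gip_sol, Fin.sum_univ_two]
      ring
    rw [this, h2]
    simp [m]
  · have h0 : ∀ c, gip solMet (φ u) (dmap φ u c) (ξ u) = 0 := fun c => by
      rw [gip_comm_s3]; exact hξ.2.2 u c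
    have : ∀ x : Fin 2 → ℝ, ∀ y : ℝ, gip solMet (φ u) (fun k => X k -
        (∑ a, ∑ b, (fff solMet φ u)⁻¹ a b * x a * dmap φ u b k + y * ξ u k)) (ξ u) =
        gip solMet (φ u) X (ξ u) - (∑ a, x a * ∑ b, (fff solMet φ u)⁻¹ a b *
          gip solMet (φ u) (dmap φ u b) (ξ u)) - y * gip solMet (φ u) (ξ u) (ξ u) := by
      intro x y
      simp only [gip_sol, Fin.sum_univ_two]
      ring
    rw [this, hξ.2.1 u]
    simp [h0]

lemma curv_trace {φ ξ : Pt 2 → Pt 3} (hφ : IsImmersion φ) (hξ : IsUnitNormal solMet φ ξ)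
    (u : Pt 2) : ∑ a, ∑ b, (fff solMet φ u)⁻¹ a b *
      gip solMet (φ u) (curvPt solMet (φ u) (dmap φ u a) (ξ u) (dmap φ u b)) (ξ u)
      = 2 * ξ u 2 ^ 2 := by
  have hEF : exp (2 * φ u 2) * exp (-(2 * φ u 2)) = 1 := by rw [← Real.exp_add]; simp
  obtain ⟨P, hP⟩ : ∃ P : Fin 3 → Fin 3 → ℝ, ∀ i j, P i j =
    ∑ a, ∑ b, (fff solMet φ u)⁻¹ a b * dmap φ u a i * dmap φ u b j := ⟨_, fun _ _ => rfl⟩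
  have p0 : ∀ k, (Pi.single 0 (exp (-(2 * φ u 2))) : Pt 3) k = P 0 k + ξ u 0 * ξ u k := by
    intro k
    rw [proj_formula hφ hξ u (Pi.single 0 (exp (-(2 * φ u 2)))) k, hP]
    simp only [gip_sol, Fin.sum_univ_two]
    simp [hEF]
  have p1 : ∀ k, (Pi.single 1 (exp (2 * φ u 2)) : Pt 3) k = P 1 k + ξ u 1 * ξ u k := by
    intro k
    rw [proj_formula hφ hξ u (Pi.single 1 (exp (2 * φ u 2))) k, hP]
    simp only [gip_sol, Fin.sum_univ_two]
    simp [hEF, mul_comm (exp (-(2 * φ u 2)))]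
  have p2 : ∀ k, (Pi.single 2 1 : Pt 3) k = P 2 k + ξ u 2 * ξ u k := by
    intro k
    rw [proj_formula hφ hξ u (Pi.single 2 1) k, hP]
    simp only [gip_sol, Fin.sum_univ_two]
    simp
  have e : ∑ a, ∑ b, (fff solMet φ u)⁻¹ a b *
      gip solMet (φ u) (curvPt solMet (φ u) (dmap φ u a) (ξ u) (dmap φ u b)) (ξ u) =
      P 0 0 * (-(exp (2 * φ u 2) * exp (-(2 * φ u 2))) * ξ u 1 ^ 2 + exp (2 * φ u 2) * ξ u 2 ^ 2)
      + (P 0 1 + P 1 0) * ((exp (2 * φ u 2) * exp (-(2 * φ u 2))) * ξ u 0 * ξ u 1)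
      + P 1 1 * (-(exp (2 * φ u 2) * exp (-(2 * φ u 2))) * ξ u 0 ^ 2
          + exp (-(2 * φ u 2)) * ξ u 2 ^ 2)
      - (P 0 2 + P 2 0) * (exp (2 * φ u 2) * ξ u 0 * ξ u 2)
      - (P 1 2 + P 2 1) * (exp (-(2 * φ u 2)) * ξ u 1 * ξ u 2)
      + P 2 2 * (exp (2 * φ u 2) * ξ u 0 ^ 2 + exp (-(2 * φ u 2)) * ξ u 1 ^ 2) := by
    simp only [hP, gip_sol, curv_sol, Fin.sum_univ_two]
    simp
    ring
  rw [e]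
  have q00 := p0 0
  have q01 := p0 1
  have q02 := p0 2
  have q10 := p1 0
  have q11 := p1 1
  have q12 := p1 2
  have q20 := p2 0
  have q21 := p2 1
  have q22 := p2 2
  simp at q00 q01 q02 q10 q11 q12 q20 q21 q22
  rw [hEF]
  have r00 : P 0 0 = exp (-(2 * φ u 2)) - ξ u 0 * ξ u 0 := by linarith
  have r01 : P 0 1 = - (ξ u 0 * ξ u 1) := by linarith
  have r02 : P 0 2 = - (ξ u 0 * ξ u 2) := by linarith
  have r10 : P 1 0 = - (ξ u 1 * ξ u 0) := by linarith
  have r11 : P 1 1 = exp (2 * φ u 2) - ξ u 1 * ξ u 1 := by linarith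
  have r12 : P 1 2 = - (ξ u 1 * ξ u 2) := by linarith
  have r20 : P 2 0 = - (ξ u 2 * ξ u 0) := by linarith
  have r21 : P 2 1 = - (ξ u 2 * ξ u 1) := by linarith
  have r22 : P 2 2 = 1 - ξ u 2 * ξ u 2 := by linarith
  rw [r00, r01, r02, r10, r11, r12, r20, r21, r22]
  linear_combination (2 * ξ u 2 ^ 2) * hEF

lemma covAlong_smul (φ V : Pt 2 → Pt 3) (c : ℝ) (a : Fin 2) :
    covAlong solMet φ (fun u => c • V u) a = fun u => c • covAlong solMet φ V a u := by
  ext u k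
  simp only [covAlong_sol, Pi.smul_apply, smul_eq_mul]
  rw [show fderiv ℝ (fun q => c * V q k) u = c • fderiv ℝ (fun q => V q k) u from
    congrFun (fderiv_const_smul_field (𝕜 := ℝ) (f := fun q => V q k) c) u]
  fin_cases k <;> simp <;> ring

lemma bitension_smul (φ ξ : Pt 2 → Pt 3) (c : ℝ) (ht : tension solMet φ = fun u => c • ξ u)
    (u : Pt 2) (k : Fin 3) : bitension solMet φ u k = c *
  ((∑ a, ∑ b, (fff solMet φ u)⁻¹ a b *
      (covAlong solMet φ (covAlong solMet φ ξ b) a u k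
        - ∑ c, christoffel (fff solMet φ) u c a b * covAlong solMet φ ξ c u k))
    - ∑ a, ∑ b, (fff solMet φ u)⁻¹ a b *
        curvPt solMet (φ u) (dmap φ u a) (ξ u) (dmap φ u b) k) := by
  have hc : ∀ v w, curvPt solMet (φ u) v (c • ξ u) w k = c * curvPt solMet (φ u) v (ξ u) w k := by
    intro v w
    rw [curv_sol, curv_sol]
    fin_cases k <;> simp <;> ring
  simp only [bitension, ht, covAlong_smul, hc, Pi.smul_apply, smul_eq_mul, Fin.sum_univ_two]
  ring

lemma main_step {φ ξ : Pt 2 → Pt 3} (hφ : IsImmersion φ) (hξ : IsUnitNormal solMet φ ξ)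
    (c : ℝ) (hc : c ≠ 0) (ht : tension solMet φ = fun u => c • ξ u) (u : Pt 2)
    (hb : bitension solMet φ u = 0) : meanCurv solMet φ ξ u = 0 := by
  have hsξ : Sm ξ := hξ.1
  have hsφ : Sm φ := hφ.1
  have hD : ∀ a u, gip solMet (φ u) (covAlong solMet φ ξ a u) (ξ u) = 0 := by
    intro a u
    have h := compat hsφ hsξ hsξ a u
    simp only [hξ.2.1] at h
    rw [gip_comm_s3 _ (ξ u)] at h
    simp at h
    linarith
  have hDD : ∀ a b, gip solMet (φ u) (covAlong solMet φ (covAlong solMet φ ξ b) a u) (ξ u) =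
      - gip solMet (φ u) (covAlong solMet φ ξ b u) (covAlong solMet φ ξ a u) := by
    intro a b
    have h := compat hsφ (sm_cov hsφ hsξ b) hsξ a u
    simp only [hD] at h
    simp at h
    linarith
  have hct := curv_trace hφ hξ u
  have hb' : gip solMet (φ u) (bitension solMet φ u) (ξ u) = c *
    ((∑ a, ∑ b, (fff solMet φ u)⁻¹ a b *
      (gip solMet (φ u) (covAlong solMet φ (covAlong solMet φ ξ b) a u) (ξ u)
        - ∑ c, christoffel (fff solMet φ) u c a b *
          gip solMet (φ u) (covAlong solMet φ ξ c u) (ξ u)))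
    - ∑ a, ∑ b, (fff solMet φ u)⁻¹ a b *
        gip solMet (φ u) (curvPt solMet (φ u) (dmap φ u a) (ξ u) (dmap φ u b)) (ξ u)) := by
    simp only [gip_sol, bitension_smul φ ξ c ht, Fin.sum_univ_two]
    ring
  rw [hb, hct] at hb'
  simp only [hD, hDD, mul_zero, Finset.sum_const_zero, sub_zero] at hb'
  have hz : gip solMet (φ u) 0 (ξ u) = 0 := by simp [gip_sol]
  rw [hz] at hb'
  have hb2 := (mul_eq_zero.1 hb'.symm).resolve_left hc
  have hpd := (fff_posdef u (hφ.2 u)).inv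
  have hq : ∀ x : Fin 2 → ℝ, x ≠ 0 → 0 < ∑ a, ∑ b, (fff solMet φ u)⁻¹ a b * (x b * x a) := by
    intro x hx
    have := hpd.dotProduct_mulVec_pos hx
    refine lt_of_lt_of_eq this ?_
    simp [dotProduct, Matrix.mulVec, Fin.sum_univ_two]
    ring
  have hq0 : ∀ x : Fin 2 → ℝ, 0 ≤ ∑ a, ∑ b, (fff solMet φ u)⁻¹ a b * (x b * x a) := by
    intro x
    by_cases hx : x = 0
    · simp [hx]
    · exact (hq x hx).le
  set Q : Fin 3 → ℝ := fun k => ∑ a, ∑ b, (fff solMet φ u)⁻¹ a b *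
    (covAlong solMet φ ξ b u k * covAlong solMet φ ξ a u k) with hQ
  have hQ0 : ∀ k, 0 ≤ Q k := fun k => hq0 fun a => covAlong solMet φ ξ a u k
  have hsum : exp (2 * φ u 2) * Q 0 + exp (-(2 * φ u 2)) * Q 1 + Q 2 + 2 * ξ u 2 ^ 2 = 0 := by
    simp only [gip_sol, Fin.sum_univ_two] at hb2
    simp only [hQ, Fin.sum_univ_two]
    linear_combination -hb2
  have e0 := Real.exp_pos (2 * φ u 2)
  have e1 := Real.exp_pos (-(2 * φ u 2))
  have t0 := mul_nonneg e0.le (hQ0 0)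
  have t1 := mul_nonneg e1.le (hQ0 1)
  have t2 := hQ0 2
  have t3 := sq_nonneg (ξ u 2)
  have z0 : Q 0 = 0 := (mul_eq_zero.1 (by linarith : exp (2 * φ u 2) * Q 0 = 0)).resolve_left e0.ne'
  have z1 : Q 1 = 0 :=
    (mul_eq_zero.1 (by linarith : exp (-(2 * φ u 2)) * Q 1 = 0)).resolve_left e1.ne'
  have z2 : Q 2 = 0 := by linarith
  have zk : ∀ k, Q k = 0 := by intro k; fin_cases k <;> assumption
  have hD0 : ∀ a, covAlong solMet φ ξ a u = 0 := by
    intro a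
    ext k
    by_contra hne
    have : (fun a => covAlong solMet φ ξ a u k) ≠ 0 := fun h => hne (congrFun h a)
    exact (hq _ this).ne' (zk k)
  have hs : ∀ a b, sff solMet φ ξ u a b = 0 := by
    intro a b
    have h := compat hsφ (sm_dmap hsφ b) hsξ a u
    have h0 : ∀ q c, gip solMet (φ q) (dmap φ q c) (ξ q) = 0 := fun q c => by
      rw [gip_comm_s3]; exact hξ.2.2 q c
    simp only [h0, hD0] at h
    have hz : gip solMet (φ u) (dmap φ u b) 0 = 0 := by simp [gip_sol]
    rw [hz] at h
    simp at h
    exact h.symm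
  simp [meanCurv, shapeOp, hs]

end helpers

/-- Proposition 2.4. A constant mean curvature surface in Sol space
`(ℝ³, g_{Sol} = e^{2z}dx² + e^{−2z}dy² + dz²)` is biharmonic if and only if it is minimal. -/
theorem cmc_biharmonic_surface_in_Sol_is_minimal
    (φ ξ : Pt 2 → Pt 3) (hφ : IsImmersion φ) (hξ : IsUnitNormal solMet φ ξ)
    (H₀ : ℝ) (hH : ∀ u, meanCurv solMet φ ξ u = H₀) :
    IsBiharmonic solMet φ ↔ IsMinimal solMet φ := by
  have ht : tension solMet φ = fun u => (2 * H₀) • ξ u := by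
    ext1 u
    rw [tension_normal hφ hξ u, hH]
  constructor
  · intro hb
    have h0 : H₀ = 0 := by
      by_contra hne
      have := main_step hφ hξ (2 * H₀) (mul_ne_zero two_ne_zero hne) ht 0 (hb 0)
      rw [hH] at this
      exact hne this
    intro u
    rw [ht, h0]
    simp
  · intro hm u
    have h0 : tension solMet φ = fun u => (0 : ℝ) • ξ u := by
      ext1 u
      rw [hm u, zero_smul]
    ext k
    rw [bitension_smul φ ξ 0 h0]
    simp
end
end
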